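/- For every k ≥ 1 and every δ ∈ (0,1) there exists a constant C = C(k,δ) > 0 with the following property: for every measurable set A ⊆ ℝ^k with 0 < |A| < ∞ satisfying |A+A| ≤ 2^k(1+δ)|A|, there exists a measurable subset A' ⊆ A with |A'| ≥ (1−δ)|A| and |co(A')| ≤ C|A|. -/

import Mathlib

open Set Pointwise MeasureTheory

theorem volume_add_volume_le_volume_add_of_isCompact {X Y : Set ℝ} (hX : IsCompact X)
    (hY : IsCompact Y) (hX₀ : X.Nonempty) (hY₀ : Y.Nonempty) :
    volume X + volume Y ≤ volume (X + Y) := by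
  obtain ⟨x, hx, hxmax⟩ := hX.exists_isGreatest hX₀
  obtain ⟨y, hy, hymin⟩ := hY.exists_isLeast hY₀
  have h1 : volume ((· + y) '' X) = volume X := by
    simp [image_add_right]
  have h2 : volume ((x + ·) '' Y) = volume Y := by
    simp [image_add_left]
  have hXm : MeasurableSet ((x + ·) '' Y) := (hY.image (by fun_prop)).measurableSet
  rw [← h1, ← h2, ← measure_union₀ hXm.nullMeasurableSet]
  · refine measure_mono (union_subset ?_ ?_)
    · rintro _ ⟨a, ha, rfl⟩
      exact add_mem_add ha hy
    · rintro _ ⟨a, ha, rfl⟩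
      exact add_mem_add hx ha
  · refine measure_mono_null (t := {x + y}) ?_ (by simp)
    rintro _ ⟨⟨a, ha, rfl⟩, ⟨b, hb, hab⟩⟩
    have := hxmax ha
    have := hymin hb
    simp only [mem_singleton_iff] at *
    linarith

theorem volume_add_volume_le_volume_add {X Y : Set ℝ} (hX : MeasurableSet X)
    (hY : MeasurableSet Y) (hX₀ : X.Nonempty) (hY₀ : Y.Nonempty) :
    volume X + volume Y ≤ volume (X + Y) := by
  obtain ⟨x, hx⟩ := hX₀
  obtain ⟨y, hy⟩ := hY₀
  have key : ∀ K, IsCompact K → K ⊆ X → ∀ L, IsCompact L → L ⊆ Y →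
      volume K + volume L ≤ volume (X + Y) := by
    intro K hK hKX L hL hLY
    calc volume K + volume L ≤ volume (insert x K) + volume (insert y L) := by
          gcongr <;> exact subset_insert _ _
      _ ≤ volume (insert x K + insert y L) :=
          volume_add_volume_le_volume_add_of_isCompact (hK.insert x) (hL.insert y)
            (insert_nonempty _ _) (insert_nonempty _ _)
      _ ≤ volume (X + Y) := measure_mono (add_subset_add (insert_subset hx hKX)
            (insert_subset hy hLY))
  rw [hX.measure_eq_iSup_isCompact, hY.measure_eq_iSup_isCompact]
  simp only [iSup_and']
  exact ENNReal.biSup_add_biSup_le' ⟨∅, empty_subset _, isCompact_empty⟩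
    ⟨∅, empty_subset _, isCompact_empty⟩ fun K hK L hL => key K hK.2 hK.1 L hL.2 hL.1

theorem lintegral_add_lintegral_le_of_mul_le_sq {f g h : ℝ → ℝ} (hf : Measurable f)
    (hg : Measurable g) (hh : Measurable h) (hf0 : 0 ≤ f) (hg0 : 0 ≤ g) (hh0 : 0 ≤ h)
    (hf1 : IsLUB (range f) 1) (hg1 : IsLUB (range g) 1)
    (hfg : ∀ x y, f x * g y ≤ h (x + y) ^ 2) :
    (∫⁻ x, ENNReal.ofReal (f x)) + ∫⁻ x, ENNReal.ofReal (g x) ≤ ∫⁻ x, ENNReal.ofReal (h x) := by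
  have layer : ∀ u : ℝ → ℝ, Measurable u → 0 ≤ u → ∫⁻ x, ENNReal.ofReal (u x) =
      ∫⁻ t in Ioi (0 : ℝ), volume {x | t < u x} := fun u hu hu0 =>
    lintegral_eq_lintegral_meas_lt volume (ae_of_all _ hu0) hu.aemeasurable
  have hm : ∀ u : ℝ → ℝ, Measurable fun t : ℝ => volume {x | t < u x} := fun u =>
    Antitone.measurable fun s t hst => measure_mono fun x hx => lt_of_le_of_lt hst hx
  rw [layer f hf hf0, layer g hg hg0, layer h hh hh0, ← lintegral_add_left (hm f)]
  refine setLIntegral_mono (hm h) fun t ht => ?_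
  have ht : 0 < t := ht
  rcases lt_or_ge t 1 with ht1 | ht1
  · obtain ⟨_, ⟨x, rfl⟩, hx⟩ := (lt_isLUB_iff hf1).1 ht1
    obtain ⟨_, ⟨y, rfl⟩, hy⟩ := (lt_isLUB_iff hg1).1 ht1
    refine (volume_add_volume_le_volume_add (measurableSet_lt measurable_const hf)
      (measurableSet_lt measurable_const hg) ⟨x, hx⟩ ⟨y, hy⟩).trans (measure_mono ?_)
    rintro _ ⟨a, ha, b, hb, rfl⟩
    have ha : t < f a := ha
    have hb : t < g b := hb
    exact lt_of_pow_lt_pow_left₀ 2 (hh0 _) (lt_of_lt_of_le (by nlinarith) (hfg a b))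
  · have e1 : {x | t < f x} = ∅ := eq_empty_of_forall_notMem fun x hx =>
      absurd (hf1.1 ⟨x, rfl⟩) (not_le.2 (lt_of_le_of_lt ht1 hx))
    have e2 : {x | t < g x} = ∅ := eq_empty_of_forall_notMem fun x hx =>
      absurd (hg1.1 ⟨x, rfl⟩) (not_le.2 (lt_of_le_of_lt ht1 hx))
    simp [e1, e2]

theorem volume_eq_lintegral_cons_preimage {k : ℕ} {A : Set (Fin (k + 1) → ℝ)}
    (hA : MeasurableSet A) :
    Measurable (fun x : ℝ => volume (Fin.cons (α := fun _ => ℝ) x ⁻¹' A)) ∧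
      volume A = ∫⁻ x : ℝ, volume (Fin.cons (α := fun _ => ℝ) x ⁻¹' A) := by
  have hp := (volume_preserving_piFinSuccAbove (fun _ : Fin (k + 1) => ℝ) 0).symm
  have hm : MeasurableSet ((MeasurableEquiv.piFinSuccAbove (fun _ : Fin (k + 1) => ℝ) 0).symm ⁻¹'
      A) := hp.measurable hA
  have hs : ∀ x : ℝ, Fin.cons (α := fun _ => ℝ) x ⁻¹' A = Prod.mk x ⁻¹'
      ((MeasurableEquiv.piFinSuccAbove (fun _ : Fin (k + 1) => ℝ) 0).symm ⁻¹' A) := by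
    intro x
    ext v
    simp [MeasurableEquiv.piFinSuccAbove, Fin.insertNthEquiv]
  simp only [hs]
  refine ⟨measurable_measure_prodMk_left hm, ?_⟩
  rw [← hp.measure_preimage hA.nullMeasurableSet]
  exact Measure.prod_apply hm

theorem IsCompact.preimage_fin_cons {k : ℕ} {A : Set (Fin (k + 1) → ℝ)}
    (hA : IsCompact A) (x : ℝ) : IsCompact (Fin.cons (α := fun _ => ℝ) x ⁻¹' A) := by
  have hc : Continuous fun v : Fin k → ℝ => (Fin.cons (α := fun _ => ℝ) x v : Fin (k + 1) → ℝ) := by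
    fun_prop
  refine (hA.image (f := fun v => Fin.tail v) (by unfold Fin.tail; fun_prop)).of_isClosed_subset
    (hA.isClosed.preimage hc) fun v hv => ⟨_, hv, by simp⟩

theorem ENNReal.four_mul_mul_le_add_sq (a b : ENNReal) : 4 * (a * b) ≤ (a + b) ^ 2 := by
  induction a with
  | top => simp
  | coe a =>
    induction b with
    | top => simp
    | coe b =>
      norm_cast
      rw [← NNReal.coe_le_coe]
      push_cast
      nlinarith [sq_nonneg ((a : ℝ) - b)]

theorem IsCompact.exists_normalized_section_volume {k : ℕ} {A : Set (Fin (k + 1) → ℝ)}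
    (hA : IsCompact A) (hA₀ : volume A ≠ 0) :
    ∃ M : ℝ, 0 < M ∧ ∃ f : ℝ → ℝ, Measurable f ∧ 0 ≤ f ∧ IsLUB (range f) 1 ∧
      (∀ x, volume (Fin.cons (α := fun _ => ℝ) x ⁻¹' A) = ENNReal.ofReal (M * f x)) ∧
      volume A = ENNReal.ofReal M * ∫⁻ x, ENNReal.ofReal (f x) := by
  obtain ⟨mA, vA⟩ := volume_eq_lintegral_cons_preimage hA.measurableSet
  have hT : IsCompact ((fun v : Fin (k + 1) → ℝ => Fin.tail v) '' A) :=
    hA.image (by unfold Fin.tail; fun_prop)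
  have hle : ∀ x : ℝ, volume (Fin.cons (α := fun _ => ℝ) x ⁻¹' A) ≤
      volume ((fun v : Fin (k + 1) → ℝ => Fin.tail v) '' A) := fun x =>
    measure_mono fun v hv => ⟨_, hv, by simp⟩
  have hfin : ∀ x : ℝ, volume (Fin.cons (α := fun _ => ℝ) x ⁻¹' A) ≠ ⊤ := fun x =>
    ((hle x).trans_lt hT.measure_lt_top).ne
  set F : ℝ → ℝ := fun x => (volume (Fin.cons (α := fun _ => ℝ) x ⁻¹' A)).toReal with hF
  have hbdd : BddAbove (range F) := by
    refine ⟨(volume ((fun v : Fin (k + 1) → ℝ => Fin.tail v) '' A)).toReal, ?_⟩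
    rintro _ ⟨x, rfl⟩
    exact ENNReal.toReal_mono hT.measure_lt_top.ne (hle x)
  have hlub : IsLUB (range F) (sSup (range F)) := isLUB_csSup (range_nonempty F) hbdd
  have hM : 0 < sSup (range F) := by
    by_contra hcon
    refine hA₀ ?_
    rw [vA]
    refine (lintegral_eq_zero_iff mA).2 (ae_of_all _ fun x => ?_)
    have h1 : F x ≤ 0 := (hlub.1 ⟨x, rfl⟩).trans (not_lt.1 hcon)
    have h2 : F x = 0 := le_antisymm h1 ENNReal.toReal_nonneg
    exact ((ENNReal.toReal_eq_zero_iff _).1 h2).resolve_right (hfin x)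
  have hs : ∀ x, volume (Fin.cons (α := fun _ => ℝ) x ⁻¹' A) =
      ENNReal.ofReal (sSup (range F) * (F x / sSup (range F))) := fun x => by
    rw [mul_div_cancel₀ _ hM.ne', hF, ENNReal.ofReal_toReal (hfin x)]
  refine ⟨sSup (range F), hM, fun x => F x / sSup (range F), mA.ennreal_toReal.div_const _,
    fun x => div_nonneg ENNReal.toReal_nonneg hM.le, ⟨?_, ?_⟩, hs, ?_⟩
  · rintro _ ⟨x, rfl⟩
    exact (div_le_one hM).2 (hlub.1 ⟨x, rfl⟩)
  · intro c hc
    have : sSup (range F) ≤ c * sSup (range F) := hlub.2 (by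
      rintro _ ⟨x, rfl⟩
      exact (div_le_iff₀ hM).1 (hc ⟨x, rfl⟩))
    by_contra hlt
    nlinarith
  · rw [vA, ← lintegral_const_mul' _ _ ENNReal.ofReal_ne_top]
    refine lintegral_congr fun x => ?_
    rw [hs x, ENNReal.ofReal_mul hM.le]

theorem four_pow_mul_volume_mul_volume_le_sq_volume_add_of_isCompact {k : ℕ} :
    ∀ {A B : Set (Fin k → ℝ)}, IsCompact A → IsCompact B →
      4 ^ k * (volume A * volume B) ≤ volume (A + B) ^ 2 := by
  induction k with
  | zero =>
    intro A B hA hB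
    rcases A.eq_empty_or_nonempty with rfl | ⟨a, ha⟩
    · simp
    rcases B.eq_empty_or_nonempty with rfl | ⟨b, hb⟩
    · simp
    have e : ∀ S : Set (Fin 0 → ℝ), S.Nonempty → S = univ := fun S hS =>
      hS.eq_univ
    rw [e _ ⟨a, ha⟩, e _ ⟨b, hb⟩]
    simp [volume_pi]
  | succ k ih =>
    intro A B hA hB
    rcases eq_or_ne (volume A) 0 with h0 | hA₀
    · simp [h0]
    rcases eq_or_ne (volume B) 0 with h0 | hB₀
    · simp [h0]
    have hAB := hA.add hB
    obtain ⟨mC, vC⟩ := volume_eq_lintegral_cons_preimage hAB.measurableSet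
    obtain ⟨M, hM, f, mf, f0, f1, hf, vA⟩ := hA.exists_normalized_section_volume hA₀
    obtain ⟨N, hN, g, mg, g0, g1, hg, vB⟩ := hB.exists_normalized_section_volume hB₀
    set R : ℝ := 2 ^ k * √(M * N) with hR
    have hR0 : 0 < R := by positivity
    have hR2 : R ^ 2 = 4 ^ k * (M * N) := by
      rw [hR, mul_pow, Real.sq_sqrt (by positivity), ← pow_mul, mul_comm k 2, pow_mul]
      norm_num
    set H : ℝ → ENNReal := fun x => volume (Fin.cons (α := fun _ => ℝ) x ⁻¹' (A + B)) with hH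
    have hHfin : ∀ x, H x ≠ ⊤ := fun x => (hAB.preimage_fin_cons x).measure_lt_top.ne
    have hsub : ∀ x y : ℝ, Fin.cons (α := fun _ => ℝ) x ⁻¹' A + Fin.cons (α := fun _ => ℝ) y ⁻¹' B ⊆
        Fin.cons (α := fun _ => ℝ) (x + y) ⁻¹' (A + B) := by
      rintro x y _ ⟨v, hv, w, hw, rfl⟩
      refine ⟨_, hv, _, hw, ?_⟩
      ext i
      refine Fin.cases ?_ (fun i => ?_) i <;> simp
    have key := lintegral_add_lintegral_le_of_mul_le_sq (f := f) (g := g)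
      (h := fun x => (H x).toReal / R) mf mg (mC.ennreal_toReal.div_const R) f0 g0
      (fun x => div_nonneg ENNReal.toReal_nonneg hR0.le) f1 g1 (by
        intro x y
        have h1 := (ih (hA.preimage_fin_cons x) (hB.preimage_fin_cons y)).trans
          (pow_le_pow_left' (measure_mono (hsub x y)) 2)
        rw [hf, hg] at h1
        have h2 := ENNReal.toReal_mono (ENNReal.pow_ne_top (hHfin (x + y))) h1
        have hfx : 0 ≤ f x := f0 x
        have hgy : 0 ≤ g y := g0 y
        rw [ENNReal.toReal_mul, ENNReal.toReal_mul, ENNReal.toReal_ofReal (by positivity),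
          ENNReal.toReal_ofReal (by positivity), ENNReal.toReal_pow, ENNReal.toReal_pow] at h2
        norm_num at h2
        rw [div_pow, le_div_iff₀ (by positivity), hR2]
        linarith)
    have vC' : volume (A + B) = ENNReal.ofReal R * ∫⁻ x, ENNReal.ofReal ((H x).toReal / R) := by
      rw [vC, ← lintegral_const_mul' _ _ ENNReal.ofReal_ne_top]
      refine lintegral_congr fun x => ?_
      rw [← ENNReal.ofReal_mul hR0.le, mul_div_cancel₀ _ hR0.ne', ENNReal.ofReal_toReal (hHfin x)]
    rw [vC', vA, vB, mul_pow, ← ENNReal.ofReal_pow hR0.le, hR2]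
    set a := ∫⁻ x, ENNReal.ofReal (f x)
    set b := ∫⁻ x, ENNReal.ofReal (g x)
    calc 4 ^ (k + 1) * (ENNReal.ofReal M * a * (ENNReal.ofReal N * b))
        = 4 ^ k * (ENNReal.ofReal M * ENNReal.ofReal N) * (4 * (a * b)) := by ring
      _ = ENNReal.ofReal (4 ^ k * (M * N)) * (4 * (a * b)) := by
          rw [ENNReal.ofReal_mul (by positivity), ENNReal.ofReal_mul hM.le,
            ENNReal.ofReal_pow (by norm_num)]
          norm_num
      _ ≤ _ := by
          gcongr
          exact (ENNReal.four_mul_mul_le_add_sq a b).trans (pow_le_pow_left' key 2)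

/-- The Brunn–Minkowski inequality for two sets of measure at least `t`. -/
theorem two_pow_mul_le_volume_add {k : ℕ} {A B : Set (Fin k → ℝ)} (hA : MeasurableSet A)
    (hB : MeasurableSet B) {t : ENNReal} (htA : t ≤ volume A) (htB : t ≤ volume B) :
    2 ^ k * t ≤ volume (A + B) := by
  rw [mul_comm]
  refine ENNReal.mul_le_of_forall_lt fun r hr c hc => ?_
  obtain ⟨K, hKA, hK, hrK⟩ := hA.exists_lt_isCompact (hr.trans_le htA)
  obtain ⟨L, hLB, hL, hrL⟩ := hB.exists_lt_isCompact (hr.trans_le htB)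
  have h := four_pow_mul_volume_mul_volume_le_sq_volume_add_of_isCompact hK hL
  have h2 : (r * c) ^ 2 ≤ volume (A + B) ^ 2 := by
    calc (r * c) ^ 2 ≤ (r * 2 ^ k) ^ 2 := by gcongr
      _ = 4 ^ k * (r * r) := by
        rw [mul_pow, ← pow_mul, mul_comm k 2, pow_mul]
        norm_num
        ring
      _ ≤ 4 ^ k * (volume K * volume L) := by gcongr
      _ ≤ volume (K + L) ^ 2 := h
      _ ≤ volume (A + B) ^ 2 := by
        gcongr
  exact (ENNReal.pow_le_pow_left_iff two_ne_zero).1 h2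
theorem ENNReal.volume_setOf_ofReal_lt (w : ENNReal) :
    volume.restrict (Ioi (0 : ℝ)) {t : ℝ | ENNReal.ofReal t < w} = w := by
  have hm : MeasurableSet {t : ℝ | ENNReal.ofReal t < w} :=
    measurableSet_lt ENNReal.measurable_ofReal measurable_const
  rw [Measure.restrict_apply hm]
  induction w with
  | top => simp
  | coe w =>
    have : {t : ℝ | ENNReal.ofReal t < w} ∩ Ioi 0 = Ioo 0 (w : ℝ) := by
      ext t
      simp only [mem_inter_iff, mem_ofPred_eq, mem_Ioi, mem_Ioo, and_comm]
      refine and_congr_left fun ht => ?_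
      rw [← ENNReal.ofReal_coe_nnreal, ENNReal.ofReal_lt_ofReal_iff_of_nonneg ht.le]
    simp [this]

theorem ENNReal.tsum_eq_lintegral_tsum_ite {ι : Type*} [Countable ι] (u : ι → ENNReal) :
    ∑' i, u i = ∫⁻ t in Ioi (0 : ℝ), ∑' i, (if ENNReal.ofReal t < u i then 1 else 0) := by
  have hm : ∀ i, MeasurableSet {t : ℝ | ENNReal.ofReal t < u i} := fun i =>
    measurableSet_lt ENNReal.measurable_ofReal measurable_const
  rw [lintegral_tsum fun i => (Measurable.ite (hm i) measurable_const
    measurable_const).aemeasurable]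
  refine tsum_congr fun i => ?_
  have : (fun t : ℝ => if ENNReal.ofReal t < u i then (1 : ENNReal) else 0) =
      {t : ℝ | ENNReal.ofReal t < u i}.indicator 1 := by
    ext t
    simp [indicator]
  rw [this, lintegral_indicator_one (hm i), ENNReal.volume_setOf_ofReal_lt]

theorem Int.two_mul_tsum_le_tsum_of_min_le {w c : ℤ → ENNReal} (hw : ∑' i, w i ≠ ⊤) {m : ℤ}
    (hm : ∀ i, w i ≤ w m) (hc : ∀ i j, min (w i) (w j) ≤ c (i + j)) :
    2 * ∑' i, (if i = m then 0 else w i) ≤ ∑' s, (if s = m + m then 0 else c s) := by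
  rw [ENNReal.tsum_eq_lintegral_tsum_ite, ENNReal.tsum_eq_lintegral_tsum_ite,
    ← lintegral_const_mul' _ _ (by simp)]
  refine lintegral_mono_ae ?_
  filter_upwards [ae_restrict_mem measurableSet_Ioi] with t ht
  have ht : 0 < ENNReal.ofReal t := ENNReal.ofReal_pos.2 ht
  have hfin : {i | ENNReal.ofReal t < w i}.Finite :=
    (ENNReal.finite_const_le_of_tsum_ne_top hw ht.ne').subset fun i (hi : _ < _) =>
      mem_ofPred.2 hi.le
  set X := hfin.toFinset with hX
  have memX : ∀ i, i ∈ X ↔ ENNReal.ofReal t < w i := fun i => by simp [hX]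
  have h1 : ∑' i, (if ENNReal.ofReal t < (if i = m then 0 else w i) then (1 : ENNReal) else 0) =
      (X.erase m).card := by
    rw [tsum_eq_sum (s := X.erase m), Finset.card_eq_sum_ones, Nat.cast_sum]
    · refine Finset.sum_congr rfl fun i hi => ?_
      obtain ⟨h, h'⟩ := Finset.mem_erase.1 hi
      simp [h, (memX i).1 h']
    · intro i hi
      rw [if_neg]
      split_ifs with h
      · simp
      · exact fun h' => hi (Finset.mem_erase.2 ⟨h, (memX i).2 h'⟩)
  have h2 : (((X + X).erase (m + m)).card : ENNReal) ≤ ∑' s, (if ENNReal.ofReal t <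
      (if s = m + m then 0 else c s) then (1 : ENNReal) else 0) := by
    refine le_trans ?_ (ENNReal.sum_le_tsum ((X + X).erase (m + m)))
    rw [Finset.card_eq_sum_ones, Nat.cast_sum]
    refine Finset.sum_le_sum fun s hs => ?_
    obtain ⟨hsm, hs⟩ := Finset.mem_erase.1 hs
    obtain ⟨i, hi, j, hj, rfl⟩ := Finset.mem_add.1 hs
    have : ENNReal.ofReal t < c (i + j) :=
      (lt_min ((memX i).1 hi) ((memX j).1 hj)).trans_le (hc i j)
    simp [hsm, this]
  rw [h1]
  refine le_trans ?_ h2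
  norm_cast
  rcases X.eq_empty_or_nonempty with h0 | ⟨i, hi⟩
  · simp [h0]
  have hmX : m ∈ X := (memX m).2 (((memX i).1 hi).trans_le (hm i))
  have hcd := cauchy_davenport_add_of_linearOrder_isCancelAdd ⟨i, hi⟩ ⟨i, hi⟩
  rw [Finset.card_erase_of_mem hmX, Finset.card_erase_of_mem (Finset.add_mem_add hmX hmX)]
  have := Finset.card_pos.2 ⟨i, hi⟩
  omega

theorem ENNReal.exists_forall_le_of_tsum_ne_top {ι : Type*} [Nonempty ι] {w : ι → ENNReal}
    (hw : ∑' i, w i ≠ ⊤) : ∃ m, ∀ i, w i ≤ w m := by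
  by_cases h : ∀ i, w i = 0
  · exact ⟨Classical.arbitrary ι, fun i => by simp [h]⟩
  push Not at h
  obtain ⟨j, hj⟩ := h
  obtain ⟨m, hm, hmax⟩ := Set.exists_max_image _ w
    (ENNReal.finite_const_le_of_tsum_ne_top hw hj) ⟨j, mem_ofPred.2 le_rfl⟩
  refine ⟨m, fun i => ?_⟩
  rcases le_total (w j) (w i) with h | h
  · exact hmax i h
  · exact h.trans hm

theorem measure_eq_tsum_inter_preimage {α : Type*} [MeasurableSpace α] (μ : Measure α)
    (S : Set α) {q : α → ℤ} (hq : Measurable q) : μ S = ∑' s, μ (S ∩ q ⁻¹' {s}) := by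
  have hU : (⋃ s : ℤ, q ⁻¹' {s}) = univ := by
    ext x
    simp
  have h : μ.restrict S (⋃ s : ℤ, q ⁻¹' {s}) = ∑' s, μ.restrict S (q ⁻¹' {s}) :=
    measure_iUnion (fun i j hij => Disjoint.preimage q (by simpa using hij))
      fun s => hq (measurableSet_singleton s)
  rw [hU, Measure.restrict_apply_univ] at h
  rw [h]
  exact tsum_congr fun s => by
    rw [Measure.restrict_apply (hq (measurableSet_singleton s)), inter_comm]

/-- If a set maps to `ℤ` by a Freiman homomorphism, its sumset is large in terms of the largest
fibre. -/
theorem exists_fibre_volume_add_le {k : ℕ} {A : Set (Fin k → ℝ)} (hA : MeasurableSet A)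
    (hfin : volume A ≠ ⊤) {p q : (Fin k → ℝ) → ℤ} (hp : Measurable p) (hq : Measurable q)
    (hpq : ∀ a ∈ A, ∀ b ∈ A, q (a + b) = p a + p b) :
    ∃ m : ℤ, volume (A ∩ p ⁻¹' {m} + A ∩ p ⁻¹' {m}) + 2 ^ (k + 1) * volume (A \ p ⁻¹' {m}) ≤
        volume (A + A) ∧
      ∀ a ∈ A, p a ≠ m →
        volume (A ∩ p ⁻¹' {m} + A ∩ p ⁻¹' {m}) + volume (A ∩ p ⁻¹' {m}) ≤ volume (A + A) := by
  have hmeas : ∀ i, MeasurableSet (A ∩ p ⁻¹' {i}) := fun i =>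
    hA.inter (hp (measurableSet_singleton i))
  have hw : ∑' i, volume (A ∩ p ⁻¹' {i}) ≠ ⊤ := by
    rwa [← measure_eq_tsum_inter_preimage volume A hp]
  obtain ⟨m, hm⟩ := ENNReal.exists_forall_le_of_tsum_ne_top hw
  have hsub : ∀ i j, A ∩ p ⁻¹' {i} + A ∩ p ⁻¹' {j} ⊆ (A + A) ∩ q ⁻¹' {i + j} := by
    rintro i j _ ⟨a, ⟨ha, rfl⟩, b, ⟨hb, rfl⟩, rfl⟩
    exact ⟨add_mem_add ha hb, hpq a ha b hb⟩
  have htot : volume (A + A) = volume ((A + A) ∩ q ⁻¹' {m + m}) +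
      ∑' s, (if s = m + m then 0 else volume ((A + A) ∩ q ⁻¹' {s})) := by
    rw [measure_eq_tsum_inter_preimage volume (A + A) hq]
    convert ENNReal.tsum_eq_add_tsum_ite (m + m)
  refine ⟨m, ?_, fun a ha ham => ?_⟩
  · have key := Int.two_mul_tsum_le_tsum_of_min_le (w := fun i => volume (A ∩ p ⁻¹' {i}))
      (c := fun s => (2 ^ k)⁻¹ * volume ((A + A) ∩ q ⁻¹' {s})) hw hm (fun i j => by
        rw [mul_comm, ← div_eq_mul_inv, ENNReal.le_div_iff_mul_le (by simp) (by simp), mul_comm]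
        exact (two_pow_mul_le_volume_add (hmeas i) (hmeas j) (min_le_left _ _)
          (min_le_right _ _)).trans (measure_mono (hsub i j)))
    have hd : volume (A \ p ⁻¹' {m}) = ∑' i, (if i = m then 0 else volume (A ∩ p ⁻¹' {i})) := by
      rw [measure_eq_tsum_inter_preimage volume _ hp]
      refine tsum_congr fun i => ?_
      split_ifs with h
      · subst h
        simp
      · congr 1
        ext x
        simp only [mem_inter_iff, mem_sdiff, mem_preimage, mem_singleton_iff]
        grind
    have hc : ∑' s, (if s = m + m then 0 else (2 ^ k)⁻¹ * volume ((A + A) ∩ q ⁻¹' {s})) =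
        (2 ^ k)⁻¹ * ∑' s, (if s = m + m then 0 else volume ((A + A) ∩ q ⁻¹' {s})) := by
      rw [← ENNReal.tsum_mul_left]
      exact tsum_congr fun s => by split_ifs <;> simp
    rw [hc, mul_comm (2 ^ k)⁻¹, ← div_eq_mul_inv, ENNReal.le_div_iff_mul_le (by simp) (by simp)]
      at key
    rw [htot, hd]
    refine add_le_add (measure_mono (hsub m m)) (le_trans (le_of_eq ?_) key)
    ring
  · rw [htot]
    refine add_le_add (measure_mono (hsub m m)) ?_
    have hne : p a + m ≠ m + m := by simpa using ham
    refine le_trans ?_ (ENNReal.le_tsum (p a + m))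
    rw [if_neg hne]
    calc volume (A ∩ p ⁻¹' {m}) = volume ((a + ·) '' (A ∩ p ⁻¹' {m})) := by
          simp only [image_add_left, measure_preimage_add]
      _ ≤ _ := measure_mono ?_
    rintro _ ⟨b, ⟨hb, hbm⟩, rfl⟩
    refine ⟨add_mem_add ha hb, ?_⟩
    have hbm : p b = m := hbm
    simp [hpq a ha b hb, hbm]
section Growth

variable {G : Type*} [AddCommGroup G] [DecidableEq G]

theorem Finset.card_nsmul_le_succ_pow (T : Finset G) (n : ℕ) :
    (n • T).card ≤ (n + 1) ^ T.card := by
  have hsub : ∀ n : ℕ, n • T ⊆ (Fintype.piFinset fun _ : T => Finset.range (n + 1)).image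
      fun c => ∑ t : T, c t • (t : G) := by
    intro n
    induction n with
    | zero =>
      intro x hx
      simp only [zero_smul, Finset.mem_zero] at hx
      subst hx
      exact Finset.mem_image.2 ⟨fun _ => 0, by simp, by simp⟩
    | succ n ih =>
      intro x hx
      rw [succ_nsmul, Finset.mem_add] at hx
      obtain ⟨y, hy, t, ht, rfl⟩ := hx
      obtain ⟨c, hc, rfl⟩ := Finset.mem_image.1 (ih hy)
      simp only [Fintype.mem_piFinset, Finset.mem_range] at hc
      refine Finset.mem_image.2 ⟨fun s => c s + if s = ⟨t, ht⟩ then 1 else 0, ?_, ?_⟩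
      · simp only [Fintype.mem_piFinset, Finset.mem_range]
        intro s
        have := hc s
        split_ifs <;> omega
      · simp [add_smul, Finset.sum_add_distrib, ite_smul]
  calc (n • T).card ≤ _ := Finset.card_le_card (hsub n)
    _ ≤ _ := Finset.card_image_le
    _ = (n + 1) ^ T.card := by simp

theorem Finset.card_nsmul_sub_nsmul_le {F : Finset G} (hF : F.Nonempty) {K : ℝ}
    (hK : ((F + F).card : ℝ) ≤ K * F.card) (m n : ℕ) :
    ((m • F - n • F).card : ℝ) ≤ K ^ (m + n) * F.card := by
  have h := Finset.pluennecke_ruzsa_inequality_nsmul_sub_nsmul_add hF F m n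
  have hpos : (0 : ℝ) < F.card := by exact_mod_cast hF.card_pos
  have h' : ((m • F - n • F).card : ℝ) ≤ ((F + F).card / F.card : ℝ) ^ (m + n) * F.card := by
    have := (NNRat.cast_le (K := ℝ)).2 h
    push_cast at this
    exact this
  refine h'.trans ?_
  gcongr
  exact (div_le_iff₀ hpos).2 hK

theorem Finset.card_nsmul_le_polynomial (K : ℝ) : ∃ D : ℕ, ∀ F : Finset G, F.Nonempty →
    ((F + F).card : ℝ) ≤ K * F.card → ∀ n : ℕ,
      ((n • F).card : ℝ) ≤ (n + 1) ^ D * (K ^ 2 * F.card) := by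
  refine ⟨⌊K ^ 4⌋₊, fun F hF hK n => ?_⟩
  have hpos : (0 : ℝ) < F.card := by exact_mod_cast hF.card_pos
  have hK1 : 1 ≤ K := by
    have : (F.card : ℝ) ≤ (F + F).card := by
      exact_mod_cast Finset.card_le_card_add_right hF
    by_contra hlt
    nlinarith
  obtain ⟨T, -, hT, hcov⟩ := Finset.ruzsa_covering_add (A := 2 • F - F) (B := F) (K := K ^ 4) hF
    (by
      have e : 2 • F - F + F = 3 • F - 1 • F := by
        rw [one_nsmul, succ_nsmul F 2, sub_add_eq_add_sub]
      rw [e]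
      exact Finset.card_nsmul_sub_nsmul_le hF hK 3 1)
  have hsub : ∀ n : ℕ, (n + 1) • F - F ⊆ n • T + (F - F) := by
    intro n
    induction n with
    | zero => simp
    | succ n ih =>
      calc (n + 1 + 1) • F - F = ((n + 1) • F - F) + F := by
            rw [succ_nsmul _ (n + 1), sub_add_eq_add_sub]
        _ ⊆ n • T + (F - F) + F := Finset.add_subset_add_right ih
        _ = n • T + (2 • F - F) := by
            rw [two_nsmul, add_assoc, sub_add_eq_add_sub]
        _ ⊆ n • T + (T + (F - F)) := Finset.add_subset_add_left hcov
        _ = (n + 1) • T + (F - F) := by rw [succ_nsmul, add_assoc]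
  have hTc : T.card ≤ ⌊K ^ 4⌋₊ := Nat.le_floor hT
  have hd : ((F - F).card : ℝ) ≤ K ^ 2 * F.card := by
    simpa using Finset.card_nsmul_sub_nsmul_le hF hK 1 1
  rcases n with - | n
  · have h1 : (1 : ℝ) ≤ F.card := by exact_mod_cast hF.card_pos
    have h2 : 1 ≤ K ^ 2 := one_le_pow₀ hK1
    simp
    nlinarith
  calc (((n + 1) • F).card : ℝ) ≤ ((n + 1) • F - F).card := by
        exact_mod_cast Finset.card_le_card_sub_right hF
    _ ≤ (n • T + (F - F)).card := by exact_mod_cast Finset.card_le_card (hsub n)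
    _ ≤ (n • T).card * (F - F).card := by exact_mod_cast Finset.card_add_le
    _ ≤ ((n + 1) ^ T.card : ℕ) * (K ^ 2 * F.card) := by
        gcongr
        exact Finset.card_nsmul_le_succ_pow T n
    _ ≤ (((n + 1 : ℕ) : ℝ) + 1) ^ ⌊K ^ 4⌋₊ * (K ^ 2 * F.card) := by
        push_cast
        gcongr ?_ * _
        calc ((n : ℝ) + 1) ^ T.card ≤ ((n : ℝ) + 1) ^ ⌊K ^ 4⌋₊ :=
              pow_le_pow_right₀ (by linarith [n.cast_nonneg (α := ℝ)]) hTc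
          _ ≤ _ := by gcongr; linarith

/-- A set of small doubling has an iterated sumset which is almost invariant under translation by
the set and has doubling bounded independently of the quality of the invariance. -/
theorem Finset.exists_nsmul_card_succ_le (K : ℝ) : ∃ L : ℝ, 1 ≤ L ∧ ∀ η : ℝ, 0 < η →
    ∃ C : ℝ, 0 < C ∧ ∀ F : Finset G, F.Nonempty → ((F + F).card : ℝ) ≤ K * F.card →
      ∃ m : ℕ, (((m + 1) • F).card : ℝ) ≤ (1 + η) * (m • F).card ∧
        ((m • F + m • F).card : ℝ) ≤ L * (m • F).card ∧ ((m • F).card : ℝ) ≤ C * F.card := by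
  obtain ⟨D, hD⟩ := Finset.card_nsmul_le_polynomial (G := G) K
  refine ⟨4 ^ (D + 1), one_le_pow₀ (by norm_num), fun η hη => ?_⟩
  obtain ⟨j₀, hj₀⟩ : ∃ j₀ : ℕ, (4 ^ (D + 1) : ℝ) / η < 2 ^ j₀ :=
    pow_unbounded_of_one_lt _ (by norm_num)
  obtain ⟨I, hI⟩ : ∃ I : ℕ, (2 : ℝ) ^ ((j₀ + 1) * D) * K ^ 2 < 4 ^ I :=
    pow_unbounded_of_one_lt _ (by norm_num)
  refine ⟨((2 ^ (j₀ + 2 * I + 1) : ℕ) + 1) ^ D * K ^ 2 + 1, by positivity, fun F hF hK => ?_⟩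
  have hpos : (0 : ℝ) < F.card := by exact_mod_cast hF.card_pos
  have hmono : ∀ {a b : ℕ}, a ≤ b → ((a • F).card : ℝ) ≤ (b • F).card := by
    intro a b hab
    exact Nat.cast_le.2 (hF.card_nsmul_mono hab)
  obtain ⟨i, hi, hstep⟩ : ∃ i < I, ((2 ^ (j₀ + 2 * (i + 1)) • F).card : ℝ) ≤
      4 ^ (D + 1) * (2 ^ (j₀ + 2 * i) • F).card := by
    by_contra hcon
    push Not at hcon
    have hgrow : ∀ i ≤ I, (4 ^ (D + 1)) ^ i * (F.card : ℝ) ≤ (2 ^ (j₀ + 2 * i) • F).card := by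
      intro i
      induction i with
      | zero =>
        intro _
        simpa using hmono (Nat.one_le_two_pow (n := j₀))
      | succ i ih =>
        intro hi
        refine le_trans ?_ (hcon i (by omega)).le
        rw [pow_succ', mul_assoc]
        exact mul_le_mul_of_nonneg_left (ih (by omega)) (by positivity)
    have h1 := hgrow I le_rfl
    have h2 := hD F hF hK (2 ^ (j₀ + 2 * I))
    have h3 : (((2 ^ (j₀ + 2 * I) : ℕ) : ℝ) + 1) ^ D ≤ 2 ^ ((j₀ + 1) * D) * (4 ^ D) ^ I := by
      calc (((2 ^ (j₀ + 2 * I) : ℕ) : ℝ) + 1) ^ D ≤ ((2 : ℝ) ^ (j₀ + 1 + 2 * I)) ^ D := by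
            gcongr
            have : (1 : ℝ) ≤ 2 ^ (j₀ + 2 * I) := one_le_pow₀ (by norm_num)
            push_cast
            rw [show j₀ + 1 + 2 * I = j₀ + 2 * I + 1 by ring, pow_succ]
            linarith
        _ = 2 ^ ((j₀ + 1) * D) * (4 ^ D) ^ I := by
            rw [← pow_mul, add_mul, pow_add, show (4 : ℝ) = 2 ^ 2 by norm_num, ← pow_mul,
              ← pow_mul]
            ring_nf
    have h4 : (4 ^ D : ℝ) ^ I * F.card * 4 ^ I ≤
        (4 ^ D : ℝ) ^ I * F.card * (2 ^ ((j₀ + 1) * D) * K ^ 2) := by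
      calc (4 ^ D : ℝ) ^ I * F.card * 4 ^ I = (4 ^ (D + 1)) ^ I * (F.card : ℝ) := by
            rw [pow_succ, mul_pow]; ring
        _ ≤ _ := h1.trans h2
        _ ≤ 2 ^ ((j₀ + 1) * D) * (4 ^ D) ^ I * (K ^ 2 * F.card) := by gcongr
        _ = _ := by ring
    exact absurd (le_of_mul_le_mul_left h4 (by positivity)) (not_le.2 hI)
  set n := 2 ^ (j₀ + 2 * i) with hn
  have hn4 : 2 ^ (j₀ + 2 * (i + 1)) = 4 * n := by
    rw [hn, mul_add, ← add_assoc, pow_add]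
    ring
  rw [hn4] at hstep
  have hnη : (4 : ℝ) ^ (D + 1) < 1 + n * η := by
    have h1 : (2 : ℝ) ^ j₀ ≤ n := by
      rw [hn]
      push_cast
      exact pow_le_pow_right₀ (by norm_num) (by omega)
    have h2 := (div_lt_iff₀ hη).1 (hj₀.trans_le h1)
    linarith
  have hnpos : (0 : ℝ) < (n • F).card := by exact_mod_cast hF.nsmul.card_pos
  obtain ⟨m, hnm, hmn, hm⟩ : ∃ m, n ≤ m ∧ m < 2 * n ∧
      (((m + 1) • F).card : ℝ) ≤ (1 + η) * (m • F).card := by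
    by_contra hcon
    push Not at hcon
    have hgrow : ∀ i ≤ n, (1 + η) ^ i * ((n • F).card : ℝ) ≤ ((n + i) • F).card := by
      intro i
      induction i with
      | zero => simp
      | succ i ih =>
        intro hi
        refine le_trans ?_ (hcon (n + i) (by omega) (by omega)).le
        rw [pow_succ', mul_assoc]
        exact mul_le_mul_of_nonneg_left (ih (by omega)) (by positivity)
    have h1 := hgrow n le_rfl
    have h2 : 1 + n * η ≤ (1 + η) ^ n := one_add_mul_le_pow (by linarith) n
    have h3 := hmono (a := n + n) (b := 4 * n) (by omega)
    have h4 : (1 + η) ^ n ≤ 4 ^ (D + 1) :=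
      le_of_mul_le_mul_right (h1.trans (h3.trans hstep)) hnpos
    linarith
  refine ⟨m, hm, ?_, ?_⟩
  · rw [← add_nsmul]
    calc (((m + m) • F).card : ℝ) ≤ ((4 * n) • F).card := hmono (by omega)
      _ ≤ 4 ^ (D + 1) * (n • F).card := hstep
      _ ≤ _ := by
        gcongr 4 ^ (D + 1) * ?_
        exact hmono hnm
  · have h1 := hD F hF hK m
    have h2 : m ≤ 2 ^ (j₀ + 2 * I + 1) := by
      have : n ≤ 2 ^ (j₀ + 2 * I) := Nat.pow_le_pow_right (by norm_num) (by omega)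
      rw [pow_succ]
      omega
    have h3 : (m : ℝ) ≤ (2 ^ (j₀ + 2 * I + 1) : ℕ) := by exact_mod_cast h2
    calc ((m • F).card : ℝ) ≤ (m + 1) ^ D * (K ^ 2 * F.card) := h1
      _ ≤ ((2 ^ (j₀ + 2 * I + 1) : ℕ) + 1) ^ D * (K ^ 2 * F.card) := by gcongr
      _ ≤ _ := by rw [← mul_assoc]; gcongr; linarith

end Growth
section Fourier

variable {k : ℕ}

/-- The half-open unit cube centred at the origin. -/
def centredCube (k : ℕ) : Set (Fin k → ℝ) := Set.pi univ fun _ => Ioc (-(1 / 2)) (1 / 2)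

theorem volume_centredCube : volume (centredCube k) = 1 := by
  norm_num [centredCube, Real.volume_pi_Ioc]

/-- The trigonometric monomial `θ ↦ exp (2 π i n·θ)`. -/
noncomputable def trigChar (n : Fin k → ℤ) (θ : Fin k → ℝ) : ℂ :=
  Complex.exp ((2 * Real.pi * (∑ j, (n j : ℝ) * θ j) : ℝ) * Complex.I)

@[fun_prop]
theorem continuous_trigChar (n : Fin k → ℤ) : Continuous (trigChar n) := by
  unfold trigChar
  fun_prop

theorem norm_trigChar (n : Fin k → ℤ) (θ : Fin k → ℝ) : ‖trigChar n θ‖ = 1 :=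
  Complex.norm_exp_ofReal_mul_I _

theorem trigChar_add (m n : Fin k → ℤ) (θ : Fin k → ℝ) :
    trigChar (m + n) θ = trigChar m θ * trigChar n θ := by
  rw [trigChar, trigChar, trigChar, ← Complex.exp_add]
  congr 1
  simp only [Pi.add_apply, Int.cast_add, add_mul, Finset.sum_add_distrib]
  push_cast
  ring

theorem trigChar_neg (n : Fin k → ℤ) (θ : Fin k → ℝ) :
    trigChar (-n) θ = starRingEnd ℂ (trigChar n θ) := by
  rw [trigChar, trigChar, ← Complex.exp_conj, map_mul, Complex.conj_ofReal, Complex.conj_I]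
  congr 1
  simp

theorem integral_trigChar (n : Fin k → ℤ) :
    ∫ θ in centredCube k, trigChar n θ = if n = 0 then 1 else 0 := by
  have hone : ∀ m : ℤ, ∫ x in Ioc (-(1 / 2) : ℝ) (1 / 2),
      Complex.exp ((2 * Real.pi * m * Complex.I) * x) = if m = 0 then 1 else 0 := by
    intro m
    split_ifs with hm
    · subst hm
      norm_num
    · have hc : (2 * Real.pi * m * Complex.I : ℂ) ≠ 0 := by
        simp [Real.pi_ne_zero, hm]
      rw [← intervalIntegral.integral_of_le (by norm_num), integral_exp_mul_complex hc]
      have : Complex.exp (2 * Real.pi * m * Complex.I * ((1 / 2 : ℝ) : ℂ)) =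
          Complex.exp (2 * Real.pi * m * Complex.I * ((-(1 / 2) : ℝ) : ℂ)) := by
        rw [Complex.exp_eq_exp_iff_exists_int]
        exact ⟨m, by push_cast; ring⟩
      rw [this, sub_self, zero_div]
  have hprod : ∀ θ : Fin k → ℝ, trigChar n θ =
      ∏ j, Complex.exp ((2 * Real.pi * (n j) * Complex.I) * θ j) := by
    intro θ
    rw [trigChar, ← Complex.exp_sum]
    congr 1
    push_cast
    rw [Finset.mul_sum, Finset.sum_mul]
    exact Finset.sum_congr rfl fun j _ => by ring
  rw [centredCube, volume_pi, Measure.restrict_pi_pi]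
  simp_rw [hprod]
  rw [integral_fintype_prod_eq_prod
    (f := fun j (x : ℝ) => Complex.exp ((2 * Real.pi * (n j) * Complex.I) * x))]
  simp_rw [hone]
  split_ifs with hn
  · simp [hn]
  · obtain ⟨j, hj⟩ := Function.ne_iff.1 hn
    exact Finset.prod_eq_zero (Finset.mem_univ j) (if_neg hj)

theorem Continuous.integrableOn_centredCube {E : Type*} [NormedAddCommGroup E]
    {f : (Fin k → ℝ) → E} (hf : Continuous f) : IntegrableOn f (centredCube k) :=
  (hf.continuousOn.integrableOn_compact
    (isCompact_univ_pi fun _ => isCompact_Icc (a := (-(1 / 2) : ℝ)) (b := 1 / 2))).mono_set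
    (Set.pi_mono fun _ _ => Ioc_subset_Icc_self)

/-- The exponential sum over a finite set of frequencies. -/
noncomputable def expSum (B : Finset (Fin k → ℤ)) (θ : Fin k → ℝ) : ℂ := ∑ b ∈ B, trigChar b θ

@[fun_prop]
theorem continuous_expSum (B : Finset (Fin k → ℤ)) : Continuous (expSum B) := by
  unfold expSum
  fun_prop

theorem norm_expSum_le (B : Finset (Fin k → ℤ)) (θ : Fin k → ℝ) : ‖expSum B θ‖ ≤ B.card := by
  refine (norm_sum_le _ _).trans ?_
  simp [norm_trigChar]

theorem integral_sum_trigChar {ι : Type*} (s : Finset ι) (n : ι → Fin k → ℤ) :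
    ∫ θ in centredCube k, ∑ i ∈ s, trigChar (n i) θ = ∑ i ∈ s, if n i = 0 then 1 else 0 := by
  rw [integral_finsetSum _ fun i _ => (continuous_trigChar (n i)).integrableOn_centredCube]
  simp_rw [integral_trigChar]

theorem integral_norm_expSum_sq (B : Finset (Fin k → ℤ)) :
    ∫ θ in centredCube k, ‖expSum B θ‖ ^ 2 = B.card := by
  have h : ∫ θ in centredCube k, ((‖expSum B θ‖ ^ 2 : ℝ) : ℂ) = B.card := by
    have e : ∀ θ, ((‖expSum B θ‖ ^ 2 : ℝ) : ℂ) =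
        ∑ p ∈ B ×ˢ B, trigChar (p.1 - p.2) θ := by
      intro θ
      push_cast
      rw [← Complex.mul_conj', expSum, map_sum, Finset.sum_mul_sum, Finset.sum_product]
      simp_rw [sub_eq_add_neg, trigChar_add, trigChar_neg]
    simp_rw [e, integral_sum_trigChar, Finset.sum_product, sub_eq_zero]
    simp
  rw [integral_complex_ofReal] at h
  exact_mod_cast h

theorem integral_expSum_sq_mul_conj (B : Finset (Fin k → ℤ)) :
    ∫ θ in centredCube k, expSum B θ ^ 2 * starRingEnd ℂ (expSum (B + B) θ) =
      (B.card : ℂ) ^ 2 := by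
  have e : ∀ θ, expSum B θ ^ 2 * starRingEnd ℂ (expSum (B + B) θ) =
      ∑ p ∈ (B ×ˢ B) ×ˢ (B + B), trigChar (p.1.1 + p.1.2 - p.2) θ := by
    intro θ
    rw [sq, expSum, expSum, map_sum, Finset.sum_mul_sum, Finset.sum_product, Finset.sum_product,
      Finset.sum_mul]
    simp_rw [sub_eq_add_neg, trigChar_add, trigChar_neg, Finset.sum_mul_sum]
  simp_rw [e, integral_sum_trigChar, Finset.sum_product, sub_eq_zero]
  have : ∀ x ∈ B, ∀ y ∈ B, (∑ c ∈ B + B, if x + y = c then (1 : ℂ) else 0) = 1 := by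
    intro x hx y hy
    simp [Finset.add_mem_add hx hy]
  rw [Finset.sum_congr rfl fun x hx => Finset.sum_congr rfl fun y hy => this x hx y hy]
  simp [sq]

/-- A set with small doubling has a large exponential sum on a set of large measure. -/
theorem volume_large_expSum {B : Finset (Fin k → ℤ)} (hB : B.Nonempty) {s : ℝ} (hs : 0 < s)
    (hBB : ((B + B).card : ℝ) ≤ s ^ 2 * B.card) :
    1 / (2 * s ^ 2 * B.card) ≤
      volume.real {θ ∈ centredCube k | B.card / (2 * s) ≤ ‖expSum B θ‖} := by
  set N : ℝ := (B.card : ℝ) with hN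
  have hNpos : 0 < N := by rw [hN]; exact_mod_cast hB.card_pos
  set S : Set (Fin k → ℝ) := {θ | N / (2 * s) ≤ ‖expSum B θ‖}
  have hSm : MeasurableSet S := (isClosed_le (by fun_prop) (by fun_prop)).measurableSet
  have hset : {θ ∈ centredCube k | N / (2 * s) ≤ ‖expSum B θ‖} = S ∩ centredCube k := by
    ext θ; exact and_comm
  rw [hset]
  set μ := volume.restrict (centredCube k) with hμ
  have hfin : IsFiniteMeasure μ := ⟨by rw [hμ]; simp [volume_centredCube]⟩
  have hpt : ∀ θ, ‖expSum B θ ^ 2 * starRingEnd ℂ (expSum (B + B) θ)‖ ≤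
      N / (4 * s) * (s * ‖expSum B θ‖ ^ 2 + ‖expSum (B + B) θ‖ ^ 2 / s) +
        S.indicator (fun _ => s ^ 2 * N ^ 3) θ := by
    intro θ
    set g := ‖expSum B θ‖ with hg
    set h := ‖expSum (B + B) θ‖ with hh
    have hg0 : 0 ≤ g := norm_nonneg _
    have hh0 : 0 ≤ h := norm_nonneg _
    have hnorm : ‖expSum B θ ^ 2 * starRingEnd ℂ (expSum (B + B) θ)‖ = g ^ 2 * h := by
      simp [hg, hh]
    rw [hnorm]
    by_cases hθ : θ ∈ S
    · rw [indicator_of_mem hθ]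
      have h1 : g ≤ N := norm_expSum_le B θ
      have h2 : h ≤ s ^ 2 * N := (norm_expSum_le _ θ).trans hBB
      have h3 : g ^ 2 * h ≤ N ^ 2 * (s ^ 2 * N) := by gcongr
      have h4 : 0 ≤ N / (4 * s) * (s * g ^ 2 + h ^ 2 / s) := by positivity
      linarith
    · rw [indicator_of_notMem hθ, add_zero]
      have h1 : g ≤ N / (2 * s) := by
        by_contra hcon
        exact hθ (le_of_lt (not_le.1 hcon))
      have h2 : 2 * (g * h) ≤ s * g ^ 2 + h ^ 2 / s := by
        have h3 : s * g ^ 2 + h ^ 2 / s - 2 * (g * h) = (s * g - h) ^ 2 / s := by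
          field_simp
          ring
        have : 0 ≤ (s * g - h) ^ 2 / s := by positivity
        linarith
      calc g ^ 2 * h = g * (g * h) := by ring
        _ ≤ N / (2 * s) * (g * h) := by gcongr
        _ = N / (4 * s) * (2 * (g * h)) := by field_simp; ring
        _ ≤ _ := by gcongr
  have i1 : Integrable (fun θ => s * ‖expSum B θ‖ ^ 2) μ :=
    Continuous.integrableOn_centredCube (by fun_prop)
  have i2 : Integrable (fun θ => ‖expSum (B + B) θ‖ ^ 2 / s) μ :=
    Continuous.integrableOn_centredCube (by fun_prop)
  have i12 : Integrable (fun θ => N / (4 * s) *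
      (s * ‖expSum B θ‖ ^ 2 + ‖expSum (B + B) θ‖ ^ 2 / s)) μ := (i1.add i2).const_mul _
  have i3 : Integrable (S.indicator (fun _ => s ^ 2 * N ^ 3)) μ :=
    (integrable_const _).indicator hSm
  have hmain : N ^ 2 ≤ N / (4 * s) * (s * N + (B + B).card / s) +
      μ.real S * (s ^ 2 * N ^ 3) := by
    calc N ^ 2 = ‖((B.card : ℂ) ^ 2)‖ := by simp [hN]
      _ ≤ ∫ θ, ‖expSum B θ ^ 2 * starRingEnd ℂ (expSum (B + B) θ)‖ ∂μ := by
        rw [← integral_expSum_sq_mul_conj]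
        exact norm_integral_le_integral_norm _
      _ ≤ ∫ θ, (N / (4 * s) * (s * ‖expSum B θ‖ ^ 2 + ‖expSum (B + B) θ‖ ^ 2 / s) +
        S.indicator (fun _ => s ^ 2 * N ^ 3) θ) ∂μ :=
        integral_mono (Continuous.integrableOn_centredCube (by fun_prop))
          (i12.add i3) hpt
      _ = _ := by
        rw [integral_add i12 i3, integral_const_mul, integral_add i1 i2,
          integral_const_mul, integral_div, integral_norm_expSum_sq, integral_norm_expSum_sq,
          integral_indicator_const _ hSm, smul_eq_mul]
  have hμS : μ.real S = volume.real (S ∩ centredCube k) := by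
    rw [hμ, measureReal_restrict_apply hSm]
  rw [hμS] at hmain
  have h1 : N / (4 * s) * (s * N + (B + B).card / s) ≤ N ^ 2 / 2 := by
    calc N / (4 * s) * (s * N + (B + B).card / s)
        ≤ N / (4 * s) * (s * N + s ^ 2 * N / s) := by gcongr
      _ = N ^ 2 / 2 := by field_simp; ring
  rw [div_le_iff₀ (by positivity)]
  have h2 : N ^ 2 * (1 / 2) ≤ N ^ 2 * (volume.real (S ∩ centredCube k) * (s ^ 2 * N)) := by
    nlinarith
  have h3 := le_of_mul_le_mul_left h2 (by positivity)
  linarith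

end Fourier
section NearInteger

variable {k : ℕ}

theorem abs_sub_round_le_of_norm_exp_sub_one_le {x ε : ℝ}
    (h : ‖Complex.exp ((2 * Real.pi * x : ℝ) * Complex.I) - 1‖ ≤ 4 * ε) :
    |x - round x| ≤ ε := by
  set t := x - round x with ht
  have hexp : Complex.exp ((2 * Real.pi * x : ℝ) * Complex.I) =
      Complex.exp (Complex.I * (2 * Real.pi * t : ℝ)) := by
    rw [Complex.exp_eq_exp_iff_exists_int]
    exact ⟨round x, by rw [ht]; push_cast; ring⟩
  rw [hexp, Complex.norm_exp_I_mul_ofReal_sub_one, Real.norm_eq_abs, abs_mul, abs_two,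
    show 2 * Real.pi * t / 2 = Real.pi * t by ring] at h
  have ht2 : |t| ≤ 1 / 2 := abs_sub_round x
  have hpi := Real.pi_pos
  have habs : |Real.pi * t| = Real.pi * |t| := by rw [abs_mul, abs_of_pos hpi]
  have hsin := Real.mul_abs_le_abs_sin (x := Real.pi * t) (by rw [habs]; nlinarith)
  rw [habs, show 2 / Real.pi * (Real.pi * |t|) = 2 * |t| by field_simp] at hsin
  linarith

theorem norm_expSum_sub_le {E B : Finset (Fin k → ℤ)} {f : Fin k → ℤ}
    (h : ∀ b ∈ B, b + f ∈ E) (θ : Fin k → ℝ) :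
    ‖expSum E θ - trigChar f θ * expSum B θ‖ ≤ E.card - B.card := by
  have hinj : Function.Injective fun b : Fin k → ℤ => b + f := add_left_injective f
  have hsub : B.image (fun b => b + f) ⊆ E := Finset.image_subset_iff.2 h
  have e : trigChar f θ * expSum B θ = expSum (B.image fun b => b + f) θ := by
    rw [expSum, expSum, Finset.sum_image hinj.injOn, Finset.mul_sum]
    exact Finset.sum_congr rfl fun b _ => by rw [trigChar_add, mul_comm]
  have e2 : expSum E θ - expSum (B.image fun b => b + f) θ =
      expSum (E \ B.image fun b => b + f) θ := by
    rw [expSum, expSum, expSum, ← Finset.sum_sdiff hsub, add_sub_cancel_right]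
  rw [e, e2]
  refine (norm_expSum_le _ θ).trans ?_
  rw [Finset.cast_card_sdiff hsub, Finset.card_image_of_injective _ hinj]

/-- For a finite set `F` of frequencies with small doubling, the set of `θ` for which all the
differences `(f - f')·θ` are close to integers has measure at least `c / #F`. -/
theorem exists_le_volume_forall_sub_round (k : ℕ) (K : ℝ) : ∃ c : ℝ, 0 < c ∧
    ∀ F : Finset (Fin k → ℤ), F.Nonempty → ((F + F).card : ℝ) ≤ K * F.card →
      c / F.card ≤ volume.real {θ ∈ centredCube k | ∀ f ∈ F, ∀ f' ∈ F,
        |(∑ j, ((f - f') j : ℝ) * θ j) - round (∑ j, ((f - f') j : ℝ) * θ j)| ≤ 1 / 16} := by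
  obtain ⟨L, hL, hη⟩ := Finset.exists_nsmul_card_succ_le (G := Fin k → ℤ) K
  have hs : 0 < √L := Real.sqrt_pos.2 (by linarith)
  have hsL : √L ^ 2 = L := Real.sq_sqrt (by linarith)
  obtain ⟨C, hC, hF⟩ := hη (1 / (16 * √L)) (by positivity)
  refine ⟨1 / (2 * L * C), by positivity, fun F hFne hFF => ?_⟩
  obtain ⟨m, hm1, hm2, hm3⟩ := hF F hFne hFF
  have hFpos : (0 : ℝ) < F.card := by exact_mod_cast hFne.card_pos
  have hBne : (m • F).Nonempty := hFne.nsmul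
  have hBpos : (0 : ℝ) < (m • F).card := by exact_mod_cast hBne.card_pos
  have hvol := volume_large_expSum hBne hs (by rwa [hsL])
  rw [hsL] at hvol
  calc 1 / (2 * L * C) / F.card = 1 / (2 * L * (C * F.card)) := by rw [div_div, mul_assoc]
    _ ≤ 1 / (2 * L * (m • F).card) := by gcongr
    _ ≤ _ := hvol
    _ ≤ _ := by
      refine measureReal_mono ?_ ?_
      · rintro θ ⟨hθ, hlarge⟩
        refine ⟨hθ, fun f hf f' hf' => abs_sub_round_le_of_norm_exp_sub_one_le ?_⟩
        have hmem : ∀ f ∈ F, ∀ b ∈ m • F, b + f ∈ (m + 1) • F := fun f hf b hb => by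
          rw [succ_nsmul]
          exact Finset.add_mem_add hb hf
        have h1 := norm_expSum_sub_le (hmem f hf) θ
        have h2 := norm_expSum_sub_le (hmem f' hf') θ
        have h3 : trigChar f θ = trigChar (f - f') θ * trigChar f' θ := by
          rw [← trigChar_add, sub_add_cancel]
        have h4 : ‖trigChar (f - f') θ - 1‖ * ‖expSum (m • F) θ‖ =
            ‖(expSum ((m + 1) • F) θ - trigChar f' θ * expSum (m • F) θ) -
              (expSum ((m + 1) • F) θ - trigChar f θ * expSum (m • F) θ)‖ := by
          rw [← one_mul (‖trigChar (f - f') θ - 1‖), ← norm_trigChar f' θ, ← norm_mul,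
            ← norm_mul, h3]
          congr 1
          ring
        have h5 := norm_sub_le (expSum ((m + 1) • F) θ - trigChar f' θ * expSum (m • F) θ)
          (expSum ((m + 1) • F) θ - trigChar f θ * expSum (m • F) θ)
        have h6 : ‖trigChar (f - f') θ - 1‖ * ((m • F).card / (2 * √L)) ≤
            4 * (1 / 16) * ((m • F).card / (2 * √L)) := by
          calc _ ≤ ‖trigChar (f - f') θ - 1‖ * ‖expSum (m • F) θ‖ := by gcongr
            _ ≤ 2 * (1 / (16 * √L) * (m • F).card) := by rw [h4]; linarith
            _ = _ := by field_simp; norm_num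
        have h7 := le_of_mul_le_mul_right h6 (by positivity)
        simpa [trigChar] using h7
      · exact ne_top_of_le_ne_top (by simp [volume_centredCube])
          (measure_mono (μ := volume) (fun θ hθ => hθ.1 : _ ⊆ centredCube k))

/-- A number in `[-1/2, 1/2]` all of whose first multiples are close to integers is small. -/
theorem abs_mul_le_of_forall_sub_round {x : ℝ} {J : ℕ} (hx : |x| ≤ 1 / 2)
    (h : ∀ j ≤ J, |j * x - round (j * x)| ≤ 1 / 8) : |J * x| ≤ 1 / 8 := by
  induction J with
  | zero => simp
  | succ J ih =>
    have h1 := ih fun j hj => h j (by omega)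
    have h2 := h (J + 1) le_rfl
    have hzero : round (((J + 1 : ℕ) : ℝ) * x) = 0 := by
      have e : ((J + 1 : ℕ) : ℝ) * x = J * x + x := by push_cast; ring
      rw [e] at h2 ⊢
      rw [abs_le] at hx h1 h2
      have h3 : (-1 : ℝ) < round (J * x + x) := by linarith
      have h4 : (round (J * x + x) : ℝ) < 1 := by linarith
      have h5 : -1 < round (J * x + x) := by exact_mod_cast h3
      have h6 : round (J * x + x) < 1 := by exact_mod_cast h4
      omega
    rwa [hzero, Int.cast_zero, sub_zero] at h2

end NearInteger
section BohrSet

variable {k : ℕ}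

/-- The set of `ξ` whose inner products with all differences of elements of `A` are close to
integers. -/
def bohrSet (A : Set (Fin k → ℝ)) : Set (Fin k → ℝ) :=
  {ξ | ∀ a ∈ A, ∀ b ∈ A, |ξ ⬝ᵥ (a - b) - round (ξ ⬝ᵥ (a - b))| ≤ 1 / 8}

theorem bohrSet_anti {A B : Set (Fin k → ℝ)} (h : A ⊆ B) : bohrSet B ⊆ bohrSet A :=
  fun _ hξ a ha b hb => hξ a (h ha) b (h hb)

theorem isClosed_setOf_abs_sub_round_le (ε : ℝ) : IsClosed {x : ℝ | |x - round x| ≤ ε} := by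
  have : {x : ℝ | |x - round x| ≤ ε} = {x : ℝ | ‖(x : UnitAddCircle)‖ ≤ ε} := by
    ext x
    simp [UnitAddCircle.norm_eq]
  rw [this]
  exact isClosed_le ((AddCircle.continuous_mk' 1).norm) continuous_const

theorem isClosed_bohrSet (A : Set (Fin k → ℝ)) : IsClosed (bohrSet A) := by
  have : bohrSet A = ⋂ a ∈ A, ⋂ b ∈ A,
      (fun ξ : Fin k → ℝ => ξ ⬝ᵥ (a - b)) ⁻¹' {x : ℝ | |x - round x| ≤ 1 / 8} := by
    ext ξ
    simp [bohrSet]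
  rw [this]
  refine isClosed_biInter fun a _ => isClosed_biInter fun b _ =>
    (isClosed_setOf_abs_sub_round_le _).preimage ?_
  unfold dotProduct
  fun_prop

/-- A set of positive measure contains a cube of differences. -/
theorem exists_forall_norm_lt_mem_sub {A : Set (Fin k → ℝ)} (hA : MeasurableSet A)
    (hpos : 0 < volume A) : ∃ r > 0, ∀ x : Fin k → ℝ, ‖x‖ < r → ∃ a ∈ A, ∃ b ∈ A, a - b = x := by
  obtain ⟨r, hr, h⟩ := Metric.mem_nhds_iff.1
    (MeasureTheory.Measure.sub_mem_nhds_zero_of_addHaar_pos volume A hA hpos)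
  exact ⟨r, hr, fun x hx => Set.mem_sub.1 (h (by simpa using hx))⟩

theorem isBounded_bohrSet {A : Set (Fin k → ℝ)} (hA : MeasurableSet A) (hpos : 0 < volume A) :
    Bornology.IsBounded (bohrSet A) := by
  obtain ⟨r, hr, h⟩ := exists_forall_norm_lt_mem_sub hA hpos
  refine (Metric.isBounded_closedBall (x := 0) (r := 1 / (4 * r))).subset fun ξ hξ => ?_
  rw [mem_closedBall_zero_iff, pi_norm_le_iff_of_nonneg (by positivity)]
  intro i
  obtain ⟨J, hJ⟩ := exists_nat_gt (|ξ i| * r)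
  have hJ0 : (0 : ℝ) < J := lt_of_le_of_lt (by positivity) hJ
  have hmul : ∀ j ≤ J, |j * (ξ i * (r / (2 * J))) - round (j * (ξ i * (r / (2 * J))))| ≤ 1 / 8 := by
    intro j hj
    have hjJ : (j : ℝ) ≤ J := by exact_mod_cast hj
    obtain ⟨a, ha, b, hb, hab⟩ := h (Pi.single i (j * (r / (2 * J)))) (by
      rw [Pi.norm_single, Real.norm_eq_abs, abs_of_nonneg (by positivity)]
      calc j * (r / (2 * J)) ≤ J * (r / (2 * J)) := by gcongr
        _ = r / 2 := by field_simp
        _ < r := by linarith)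
    have := hξ a ha b hb
    rwa [hab, dotProduct_single, mul_left_comm] at this
  have hx : |ξ i * (r / (2 * J))| ≤ 1 / 2 := by
    rw [abs_mul, abs_of_pos (by positivity : 0 < r / (2 * J)), ← mul_div_assoc,
      div_le_iff₀ (by positivity)]
    linarith
  have := abs_mul_le_of_forall_sub_round hx hmul
  rw [show J * (ξ i * (r / (2 * J))) = ξ i * (r / 2) by field_simp, abs_mul,
    abs_of_pos (by positivity : 0 < r / 2)] at this
  rw [Real.norm_eq_abs, le_div_iff₀ (by positivity)]
  linarith

theorem volume_bohrSet_ne_top {A : Set (Fin k → ℝ)} (hA : MeasurableSet A)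
    (hpos : 0 < volume A) : volume (bohrSet A) ≠ ⊤ :=
  (isBounded_bohrSet hA hpos).measure_lt_top.ne

end BohrSet
section Discretization

variable {k : ℕ}

/-- The index of the cell of the cubic grid of mesh `1 / N` containing a point. -/
noncomputable def gridIndex (N : ℕ) (x : Fin k → ℝ) : Fin k → ℤ := fun i => ⌊N * x i⌋

theorem gridIndex_preimage_singleton {N : ℕ} (hN : 0 < N) (n : Fin k → ℤ) :
    gridIndex N ⁻¹' {n} = Set.pi univ fun i => Ico ((n i : ℝ) / N) ((n i + 1) / N) := by
  have hN' : (0 : ℝ) < N := by exact_mod_cast hN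
  ext x
  simp only [mem_preimage, mem_singleton_iff, funext_iff, gridIndex, Int.floor_eq_iff, Set.mem_pi,
    mem_univ, forall_true_left, mem_Ico, div_le_iff₀ hN', lt_div_iff₀ hN', mul_comm]

theorem volume_real_gridIndex_preimage {N : ℕ} (hN : 0 < N) (s : Finset (Fin k → ℤ)) :
    volume.real (gridIndex N ⁻¹' (s : Set (Fin k → ℤ))) = s.card / (N : ℝ) ^ k := by
  have hcell : ∀ n : Fin k → ℤ, volume (gridIndex N ⁻¹' {n}) = ENNReal.ofReal (1 / N ^ k) := by
    intro n
    rw [gridIndex_preimage_singleton hN, Real.volume_pi_Ico]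
    simp only [← sub_div, add_sub_cancel_left, Finset.prod_const, Finset.card_univ,
      Fintype.card_fin]
    rw [← ENNReal.ofReal_pow (by positivity), one_div_pow]
  have hunion : gridIndex N ⁻¹' (s : Set (Fin k → ℤ)) = ⋃ n ∈ s, gridIndex N ⁻¹' {n} := by
    ext x
    simp
  rw [hunion, measureReal_biUnion_finset (h := fun n _ => by simp [hcell])]
  · simp only [Measure.real, hcell, Finset.sum_const, nsmul_eq_mul]
    rw [ENNReal.toReal_ofReal (by positivity)]
    ring
  · intro m _ n _ hmn
    exact (Set.disjoint_singleton.2 hmn).preimage _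
  · intro n _
    rw [gridIndex_preimage_singleton hN]
    exact MeasurableSet.univ_pi fun _ => measurableSet_Ico

theorem finite_image_gridIndex (N : ℕ) {K : Set (Fin k → ℝ)} (hK : IsCompact K) :
    (gridIndex N '' K).Finite := by
  obtain ⟨l, hl⟩ := hK.isBounded.bddBelow
  obtain ⟨u, hu⟩ := hK.isBounded.bddAbove
  refine (Set.finite_Icc (gridIndex N l) (gridIndex N u)).subset ?_
  rintro _ ⟨x, hx, rfl⟩
  constructor <;> intro i <;> refine Int.floor_le_floor ?_
  · gcongr
    exact hl hx i
  · gcongr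
    exact hu hx i

theorem gridIndex_preimage_image_add_subset {N : ℕ} (hN : 0 < N) (K : Set (Fin k → ℝ)) :
    gridIndex N ⁻¹' (gridIndex N '' K + gridIndex N '' K) ⊆ Metric.cthickening (2 / N) (K + K) := by
  have hN' : (0 : ℝ) < N := by exact_mod_cast hN
  rintro x ⟨_, ⟨a, ha, rfl⟩, _, ⟨b, hb, rfl⟩, hx⟩
  refine Metric.mem_cthickening_of_dist_le x (a + b) _ _ (Set.add_mem_add ha hb) ?_
  rw [dist_pi_le_iff (by positivity)]
  intro i
  have hxi : ⌊N * a i⌋ + ⌊N * b i⌋ = ⌊N * x i⌋ := congrFun hx i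
  have hxi' : (⌊N * a i⌋ : ℝ) + ⌊N * b i⌋ = ⌊N * x i⌋ := by exact_mod_cast hxi
  have h1 := Int.floor_le ((N : ℝ) * a i)
  have h2 := Int.lt_floor_add_one ((N : ℝ) * a i)
  have h3 := Int.floor_le ((N : ℝ) * b i)
  have h4 := Int.lt_floor_add_one ((N : ℝ) * b i)
  have h5 := Int.floor_le ((N : ℝ) * x i)
  have h6 := Int.lt_floor_add_one ((N : ℝ) * x i)
  rw [Real.dist_eq, le_div_iff₀ hN', ← abs_of_pos hN', ← abs_mul, abs_le,
    Pi.add_apply]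
  constructor <;> nlinarith

/-- For a fine enough grid, the dilates of frequencies which are almost orthogonal to the
discretized set modulo integers belong to the Bohr set of the original set. -/
theorem smul_mem_bohrSet {N : ℕ} (hN : 0 < N) {K : Set (Fin k → ℝ)} {r : ℝ}
    (hr : ∀ x : Fin k → ℝ, ‖x‖ < r → ∃ a ∈ K, ∃ b ∈ K, a - b = x) (hNr : 2 * k / N < r)
    {θ : Fin k → ℝ} (hθ : θ ∈ centredCube k)
    (h : ∀ a ∈ K, ∀ b ∈ K, |(∑ j, ((gridIndex N a - gridIndex N b) j : ℝ) * θ j) -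
      round (∑ j, ((gridIndex N a - gridIndex N b) j : ℝ) * θ j)| ≤ 1 / 16) :
    (N : ℝ) • θ ∈ bohrSet K := by
  have hN' : (0 : ℝ) < N := by exact_mod_cast hN
  have hsmall : ∀ i, |((2 * k : ℕ) : ℝ) * θ i| ≤ 1 / 8 := by
    intro i
    refine abs_mul_le_of_forall_sub_round ?_ fun j hj => ?_
    · have := hθ i (mem_univ i)
      rw [abs_le]
      exact ⟨this.1.le, this.2⟩
    · have hj' : (j : ℝ) ≤ 2 * k := by exact_mod_cast hj
      obtain ⟨a, ha, b, hb, hab⟩ := hr (Pi.single i (j / N)) (by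
        rw [Pi.norm_single, Real.norm_eq_abs, abs_of_nonneg (by positivity)]
        exact lt_of_le_of_lt (by gcongr) hNr)
      have hidx : gridIndex N a - gridIndex N b = Pi.single i (j : ℤ) := by
        ext l
        have hl : a l = b l + (Pi.single i ((j : ℝ) / N) : Fin k → ℝ) l := by
          rw [← hab, Pi.sub_apply]
          ring
        rw [Pi.sub_apply, gridIndex, gridIndex, hl]
        by_cases hli : l = i
        · subst hli
          rw [Pi.single_eq_same, Pi.single_eq_same, mul_add, mul_div_cancel₀ _ hN'.ne',
            Int.floor_add_natCast, add_sub_cancel_left]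
        · rw [Pi.single_eq_of_ne hli, Pi.single_eq_of_ne hli, add_zero, sub_self]
      have hsum : ∑ l, (((Pi.single i (j : ℤ) : Fin k → ℤ) l : ℤ) : ℝ) * θ l = j * θ i := by
        rw [Finset.sum_eq_single i]
        · simp
        · intro l _ hl
          simp [hl]
        · simp
      have := h a ha b hb
      rw [hidx, hsum] at this
      linarith
  have hsum : ∑ i, |θ i| ≤ 1 / 16 := by
    rcases k.eq_zero_or_pos with rfl | hk
    · simp
    · have hk' : (0 : ℝ) < k := by exact_mod_cast hk
      have : ∀ i ∈ Finset.univ, |θ i| ≤ 1 / (16 * k) := by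
        intro i _
        have := hsmall i
        rw [abs_mul, Nat.abs_cast] at this
        push_cast at this
        rw [le_div_iff₀ (by positivity)]
        linarith
      refine (Finset.sum_le_card_nsmul _ _ _ this).trans_eq ?_
      simp only [Finset.card_univ, Fintype.card_fin, nsmul_eq_mul]
      field_simp
  intro a ha b hb
  set x := ∑ j, ((gridIndex N a - gridIndex N b) j : ℝ) * θ j with hx
  have hdiff : |((N : ℝ) • θ) ⬝ᵥ (a - b) - x| ≤ 1 / 16 := by
    have e : ((N : ℝ) • θ) ⬝ᵥ (a - b) - x =
        ∑ j, (Int.fract (N * a j) - Int.fract (N * b j)) * θ j := by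
      rw [hx, dotProduct, ← Finset.sum_sub_distrib]
      refine Finset.sum_congr rfl fun j _ => ?_
      simp only [Pi.smul_apply, Pi.sub_apply, smul_eq_mul, gridIndex, Int.fract]
      push_cast
      ring
    rw [e]
    refine (Finset.abs_sum_le_sum_abs _ _).trans (le_trans (Finset.sum_le_sum fun j _ => ?_) hsum)
    rw [abs_mul]
    refine mul_le_of_le_one_left (abs_nonneg _) (abs_le.2 ⟨?_, ?_⟩) <;>
    linarith [Int.fract_nonneg ((N : ℝ) * a j), Int.fract_nonneg ((N : ℝ) * b j),
      Int.fract_lt_one ((N : ℝ) * a j), Int.fract_lt_one ((N : ℝ) * b j)]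
  refine (round_le _ (round x)).trans ?_
  calc |((N : ℝ) • θ) ⬝ᵥ (a - b) - round x|
      ≤ |((N : ℝ) • θ) ⬝ᵥ (a - b) - x| + |x - round x| := abs_sub_le _ _ _
    _ ≤ 1 / 16 + 1 / 16 := add_le_add hdiff (h a ha b hb)
    _ = 1 / 8 := by norm_num

theorem exists_le_volume_bohrSet_of_isCompact (k : ℕ) {κ : ℝ} (hκ : 0 < κ) : ∃ c : ℝ, 0 < c ∧
    ∀ K : Set (Fin k → ℝ), IsCompact K → 0 < volume K →
      volume.real (K + K) < κ * volume.real K →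
        c / volume.real K ≤ volume.real (bohrSet K) := by
  obtain ⟨c, hc, hF⟩ := exists_le_volume_forall_sub_round k κ
  refine ⟨c / κ, by positivity, fun K hK hpos hdoub => ?_⟩
  obtain ⟨r, hr, hball⟩ := exists_forall_norm_lt_mem_sub hK.measurableSet hpos
  have hKpos : 0 < volume.real K := ENNReal.toReal_pos hpos.ne' hK.measure_lt_top.ne
  have hKK : IsCompact (K + K) := hK.add hK
  have hlim (C : ℝ) : Filter.Tendsto (fun N : ℕ => C / (N : ℝ)) Filter.atTop (nhds 0) :=
    tendsto_const_div_atTop_nhds_zero_nat C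
  have hthick : Filter.Tendsto (fun N : ℕ => volume.real (Metric.cthickening (2 / N) (K + K)))
      Filter.atTop (nhds (volume.real (K + K))) :=
    (ENNReal.tendsto_toReal hKK.measure_lt_top.ne).comp
      ((tendsto_measure_cthickening_of_isCompact hKK).comp (hlim 2))
  obtain ⟨N, hN1, hN2, hN3⟩ := ((hthick.eventually_lt_const hdoub).and
    (((hlim (2 * k)).eventually_lt_const hr).and (Filter.eventually_gt_atTop 0))).exists
  have hN' : (0 : ℝ) < N := by exact_mod_cast hN3
  set F : Finset (Fin k → ℤ) := (finite_image_gridIndex N hK).toFinset with hFdef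
  have hFcoe : (F : Set (Fin k → ℤ)) = gridIndex N '' K := by simp [hFdef]
  have hKne : K.Nonempty := nonempty_of_measure_ne_zero hpos.ne'
  have hFne : F.Nonempty := by
    rw [← Finset.coe_nonempty, hFcoe]
    exact hKne.image _
  have hFpos : (0 : ℝ) < F.card := by exact_mod_cast hFne.card_pos
  have hlow : volume.real K ≤ F.card / (N : ℝ) ^ k := by
    rw [← volume_real_gridIndex_preimage hN3, hFcoe]
    refine measureReal_mono (subset_preimage_image _ _) ?_
    rw [← hFcoe]
    intro htop
    have := volume_real_gridIndex_preimage hN3 F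
    rw [Measure.real, htop, ENNReal.toReal_top] at this
    have : 0 < F.card / (N : ℝ) ^ k := by positivity
    linarith
  have hup : ((F + F).card : ℝ) / (N : ℝ) ^ k ≤ κ * volume.real K := by
    rw [← volume_real_gridIndex_preimage hN3, Finset.coe_add, hFcoe]
    refine (measureReal_mono (gridIndex_preimage_image_add_subset hN3 K) ?_).trans hN1.le
    exact (hKK.isBounded.cthickening).measure_lt_top.ne
  have hFF : ((F + F).card : ℝ) ≤ κ * F.card := by
    have h1 := hup.trans (mul_le_mul_of_nonneg_left hlow hκ.le)
    rw [← mul_div_assoc] at h1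
    exact (div_le_div_iff_of_pos_right (by positivity)).1 h1
  have hcard : (F.card : ℝ) / (N : ℝ) ^ k ≤ κ * volume.real K := by
    refine le_trans ?_ hup
    have : (F.card : ℝ) ≤ (F + F).card := by
      exact_mod_cast Finset.card_le_card_add_right hFne
    gcongr
  have hD := hF F hFne hFF
  set D := {θ ∈ centredCube k | ∀ f ∈ F, ∀ f' ∈ F,
    |(∑ j, ((f - f') j : ℝ) * θ j) - round (∑ j, ((f - f') j : ℝ) * θ j)| ≤ 1 / 16}
  have hsub : (N : ℝ) • D ⊆ bohrSet K := by
    rintro _ ⟨θ, ⟨hθ, h⟩, rfl⟩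
    have hmem : ∀ a ∈ K, gridIndex N a ∈ F := fun a ha => by
      rw [← Finset.mem_coe, hFcoe]
      exact mem_image_of_mem _ ha
    exact smul_mem_bohrSet hN3 hball hN2 hθ fun a ha b hb => h _ (hmem a ha) _ (hmem b hb)
  calc c / κ / volume.real K = c / (κ * volume.real K) := div_div _ _ _
    _ ≤ c / (F.card / (N : ℝ) ^ k) := by gcongr
    _ = (N : ℝ) ^ k * (c / F.card) := by field_simp
    _ ≤ (N : ℝ) ^ k * volume.real D := by gcongr
    _ = volume.real ((N : ℝ) • D) := by
      rw [Measure.real, Measure.real, Measure.addHaar_smul, ENNReal.toReal_mul,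
        ENNReal.toReal_ofReal (abs_nonneg _), abs_of_nonneg (by positivity)]
      simp
    _ ≤ _ := measureReal_mono hsub (volume_bohrSet_ne_top hK.measurableSet hpos)

end Discretization
section Polar

variable {k : ℕ}

/-- The Bohr set of a set of small doubling is large. -/
theorem exists_le_volume_bohrSet (k : ℕ) {κ : ℝ} (hκ : 0 < κ) : ∃ c : ℝ, 0 < c ∧
    ∀ A : Set (Fin k → ℝ), MeasurableSet A → 0 < volume A → volume A < ⊤ →
      volume (A + A) ≤ ENNReal.ofReal κ * volume A →
        ENNReal.ofReal (c / volume.real A) ≤ volume (bohrSet A) := by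
  obtain ⟨c, hc, hcomp⟩ := exists_le_volume_bohrSet_of_isCompact k (κ := 2 * κ) (by positivity)
  refine ⟨c, hc, fun A hA hpos hfin hdoub => ?_⟩
  have hAA : volume (A + A) ≠ ⊤ :=
    ne_top_of_le_ne_top (ENNReal.mul_ne_top ENNReal.ofReal_ne_top hfin.ne) hdoub
  have hdoub' : volume.real (A + A) ≤ κ * volume.real A := by
    have := ENNReal.toReal_mono (ENNReal.mul_ne_top ENNReal.ofReal_ne_top hfin.ne) hdoub
    rwa [ENNReal.toReal_mul, ENNReal.toReal_ofReal hκ.le] at this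
  have hApos : 0 < volume.real A := ENNReal.toReal_pos hpos.ne' hfin.ne
  obtain ⟨K, hKA, hK, hKvol⟩ := hA.exists_lt_isCompact (ENNReal.half_lt_self hpos.ne' hfin.ne)
  have hKhalf : volume.real A / 2 < volume.real K := by
    have := (ENNReal.toReal_lt_toReal (by finiteness) hK.measure_lt_top.ne).2 hKvol
    simpa [Measure.real] using this
  have hKpos : 0 < volume K := lt_of_le_of_lt bot_le hKvol
  have : Nonempty A := (nonempty_of_measure_ne_zero hpos.ne').to_subtype
  set u : ℕ → A := TopologicalSpace.denseSeq A
  set L : ℕ → Set (Fin k → ℝ) := fun n => K ∪ (fun i => (u i : Fin k → ℝ)) '' Iic n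
  have hLmono : Monotone L := fun m n hmn =>
    union_subset_union_right _ (image_mono (Iic_subset_Iic.2 hmn))
  have hLcomp : ∀ n, IsCompact (L n) := fun n => hK.union ((Set.finite_Iic n).image _).isCompact
  have hLA : ∀ n, L n ⊆ A := fun n => union_subset hKA (by rintro _ ⟨i, -, rfl⟩; exact (u i).2)
  have hLpos : ∀ n, 0 < volume (L n) := fun n =>
    hKpos.trans_le (measure_mono subset_union_left)
  have hLvol : ∀ n, ENNReal.ofReal (c / volume.real A) ≤ volume (bohrSet (L n)) := by
    intro n
    have hLA' : volume.real (L n) ≤ volume.real A := measureReal_mono (hLA n) hfin.ne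
    have hLK : volume.real K ≤ volume.real (L n) :=
      measureReal_mono subset_union_left (hLcomp n).measure_lt_top.ne
    have h := hcomp (L n) (hLcomp n) (hLpos n) (by
      have h1 : volume.real (L n + L n) ≤ volume.real (A + A) :=
        measureReal_mono (Set.add_subset_add (hLA n) (hLA n)) hAA
      nlinarith)
    refine ENNReal.ofReal_le_of_le_toReal (le_trans ?_ h)
    have : 0 < volume.real (L n) := by linarith
    gcongr
  have hinter : ⋂ n, bohrSet (L n) = bohrSet A := by
    refine Subset.antisymm (fun ξ hξ => ?_) (subset_iInter fun n => bohrSet_anti (hLA n))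
    have hdense : DenseRange u := TopologicalSpace.denseRange_denseSeq A
    have hall : ∀ a b : A, ξ ⬝ᵥ ((a : Fin k → ℝ) - b) ∈ {x : ℝ | |x - round x| ≤ 1 / 8} := by
      intro a b
      refine hdense.induction_on₂
        (p := fun a b : A => ξ ⬝ᵥ ((a : Fin k → ℝ) - b) ∈ {x : ℝ | |x - round x| ≤ 1 / 8})
        ?_ ?_ a b
      · refine (isClosed_setOf_abs_sub_round_le (1 / 8)).preimage
          (f := fun q : A × A => ξ ⬝ᵥ ((q.1 : Fin k → ℝ) - q.2)) ?_
        unfold dotProduct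
        fun_prop
      · intro i j
        have hmem : ∀ l ≤ max i j, (u l : Fin k → ℝ) ∈ L (max i j) := fun l hl =>
          Or.inr ⟨l, hl, rfl⟩
        exact mem_iInter.1 hξ (max i j) _ (hmem i (le_max_left _ _)) _ (hmem j (le_max_right _ _))
    exact fun a ha b hb => hall ⟨a, ha⟩ ⟨b, hb⟩
  have hlim := tendsto_measure_iInter_atTop (μ := volume)
    (fun n => (isClosed_bohrSet (L n)).measurableSet.nullMeasurableSet)
    (fun m n hmn => bohrSet_anti (hLmono hmn))
    ⟨0, volume_bohrSet_ne_top (hLcomp 0).measurableSet (hLpos 0)⟩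
  rw [hinter] at hlim
  exact ge_of_tendsto' hlim hLvol

theorem volume_univ_pi_Icc_neg (a : ℝ) :
    volume (Set.pi univ fun _ : Fin k => Icc (-a) a) = ENNReal.ofReal (2 * a) ^ k := by
  rw [volume_pi_pi]
  simp [two_mul]

/-- A determinant bound for differences of `A` in terms of the volume of a polar set. -/
theorem mul_abs_det_le_of_polar {A : Set (Fin k → ℝ)} {v : ℝ}
    (hP : ENNReal.ofReal v ≤ volume {ξ : Fin k → ℝ | ∀ a ∈ A, ∀ b ∈ A, |ξ ⬝ᵥ (a - b)| ≤ 1 / 4})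
    {X : Matrix (Fin k) (Fin k) ℝ} (hX : ∀ i, X i ∈ A - A) : v * |X.det| ≤ (1 / 2) ^ k := by
  rcases eq_or_ne X.det 0 with h0 | h0
  · rw [h0, abs_zero, mul_zero]
    positivity
  have hsub : {ξ : Fin k → ℝ | ∀ a ∈ A, ∀ b ∈ A, |ξ ⬝ᵥ (a - b)| ≤ 1 / 4} ⊆
      Matrix.toLin' X ⁻¹' (Set.pi univ fun _ : Fin k => Icc (-(1 / 4)) (1 / 4)) := by
    intro ξ hξ i _
    obtain ⟨a, ha, b, hb, hab⟩ := Set.mem_sub.1 (hX i)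
    have := hξ a ha b hb
    rw [hab, abs_le, dotProduct_comm] at this
    exact this
  have h := hP.trans (measure_mono hsub)
  have hdet : LinearMap.det (Matrix.toLin' X) = X.det := LinearMap.det_toLin' X
  rw [Measure.addHaar_preimage_linearMap _ (by rwa [hdet]), hdet, volume_univ_pi_Icc_neg,
    ← ENNReal.ofReal_pow (by norm_num), ← ENNReal.ofReal_mul (by positivity),
    ENNReal.ofReal_le_ofReal_iff (by positivity), abs_inv] at h
  have hpos : 0 < |X.det| := abs_pos.2 h0
  rw [inv_mul_eq_div, le_div_iff₀ hpos] at h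
  norm_num at h ⊢
  exact h

/-- A set of positive measure whose polar is large has a convex hull of bounded volume. -/
theorem volume_convexHull_le_of_polar {A : Set (Fin k → ℝ)} (hA : MeasurableSet A)
    (hpos : 0 < volume A) {v : ℝ} (hv : 0 < v)
    (hP : ENNReal.ofReal v ≤
      volume {ξ : Fin k → ℝ | ∀ a ∈ A, ∀ b ∈ A, |ξ ⬝ᵥ (a - b)| ≤ 1 / 4}) :
    volume (convexHull ℝ A) ≤ ENNReal.ofReal (2 ^ k / v) := by
  set S : Set ℝ := {d | ∃ X : Matrix (Fin k) (Fin k) ℝ, (∀ i, X i ∈ A - A) ∧ d = |X.det|}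
  have hbdd : BddAbove S := by
    refine ⟨(1 / 2) ^ k / v, ?_⟩
    rintro _ ⟨X, hX, rfl⟩
    rw [le_div_iff₀' hv]
    exact mul_abs_det_le_of_polar hP hX
  obtain ⟨r, hr, hball⟩ := exists_forall_norm_lt_mem_sub hA hpos
  have hmem : (r / 2) ^ k ∈ S := by
    refine ⟨Matrix.diagonal fun _ => r / 2, fun i => ?_, ?_⟩
    · obtain ⟨a, ha, b, hb, hab⟩ := hball (Pi.single i (r / 2)) (by
        rw [Pi.norm_single, Real.norm_eq_abs, abs_of_pos (by positivity)]
        linarith)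
      refine Set.mem_sub.2 ⟨a, ha, b, hb, hab.trans ?_⟩
      ext j
      rw [Matrix.diagonal_apply, Pi.single_apply]
      simp only [eq_comm]
    · rw [Matrix.det_diagonal]
      simp only [Finset.prod_const, Finset.card_univ, Fintype.card_fin]
      rw [abs_of_pos (by positivity)]
  have hM : 0 < sSup S := lt_of_lt_of_le (by positivity) (le_csSup hbdd hmem)
  obtain ⟨_, ⟨X, hX, rfl⟩, hXM⟩ := exists_lt_of_lt_csSup ⟨_, hmem⟩ (half_lt_self hM)
  have hdetpos : 0 < |X.det| := by linarith
  have hdet0 : X.det ≠ 0 := abs_pos.1 hdetpos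
  set T : Set (Fin k → ℝ) :=
    Matrix.toLin' X.transpose '' (Set.pi univ fun _ : Fin k => Icc (-2) 2) with hT
  have hTconv : Convex ℝ T := (convex_pi fun _ _ => convex_Icc _ _).linear_image _
  have hTvol : volume T ≤ ENNReal.ofReal (2 ^ k / v) := by
    rw [hT, Measure.addHaar_image_linearMap, LinearMap.det_toLin', Matrix.det_transpose,
      volume_univ_pi_Icc_neg, ← ENNReal.ofReal_pow (by norm_num),
      ← ENNReal.ofReal_mul (by positivity)]
    refine ENNReal.ofReal_le_ofReal ?_
    rw [le_div_iff₀ hv]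
    have := mul_abs_det_le_of_polar hP hX
    calc |X.det| * (2 * 2) ^ k * v = (v * |X.det|) * (2 * 2) ^ k := by ring
      _ ≤ (1 / 2) ^ k * (2 * 2) ^ k := by gcongr
      _ = 2 ^ k := by rw [← mul_pow]; norm_num
  have hsub : A - A ⊆ T := by
    intro w hw
    refine ⟨X.det⁻¹ • X.transpose.cramer w, fun i _ => ?_, ?_⟩
    · rw [Pi.smul_apply, Matrix.cramer_transpose_apply, smul_eq_mul, mem_Icc, ← abs_le, abs_mul,
        abs_inv, inv_mul_le_iff₀ hdetpos]
      have : |(X.updateRow i w).det| ≤ sSup S := by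
        refine le_csSup hbdd ⟨_, fun j => ?_, rfl⟩
        by_cases hji : j = i
        · subst hji
          rwa [Matrix.updateRow_self]
        · rw [Matrix.updateRow_ne hji]
          exact hX j
      linarith
    · rw [Matrix.toLin'_apply, Matrix.mulVec_smul, Matrix.mulVec_cramer, Matrix.det_transpose,
        smul_smul, inv_mul_cancel₀ hdet0, one_smul]
  obtain ⟨a, ha⟩ := nonempty_of_measure_ne_zero hpos.ne'
  have hAT : A ⊆ a +ᵥ T := fun b hb =>
    ⟨b - a, hsub (Set.sub_mem_sub hb ha), by simp⟩
  calc volume (convexHull ℝ A) ≤ volume (a +ᵥ T) :=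
        measure_mono (convexHull_min hAT (hTconv.vadd a))
    _ = volume T := measure_vadd _ _ _
    _ ≤ _ := hTvol

end Polar
theorem round_eq_of_abs_sub_lt {x : ℝ} {n : ℤ} (h : |x - n| < 1 / 2) : round x = n := by
  have h1 := abs_sub_round x
  rw [abs_le] at h1
  rw [abs_lt] at h
  have h2 : (-1 : ℝ) < (round x - n : ℤ) := by push_cast; linarith
  have h3 : ((round x - n : ℤ) : ℝ) < 1 := by push_cast; linarith
  have h4 : -1 < round x - n := by exact_mod_cast h2
  have h5 : round x - n < 1 := by exact_mod_cast h3
  omega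

theorem measurable_round_dotProduct_sub {k : ℕ} (ξ b : Fin k → ℝ) :
    Measurable fun x : Fin k → ℝ => round (ξ ⬝ᵥ (x - b)) := by
  have h : Continuous fun x : Fin k → ℝ => ξ ⬝ᵥ (x - b) + 1 / 2 := by
    unfold dotProduct
    fun_prop
  simp_rw [round_eq]
  exact Int.measurable_floor.comp h.measurable

/-- If some element of the Bohr set of `A` is not small on the differences of `A`, then `A` can be
replaced by a subset of substantially smaller sumset. -/
theorem exists_subset_volume_add_le {k : ℕ} {A : Set (Fin k → ℝ)} (hA : MeasurableSet A)
    (hfin : volume A ≠ ⊤) {ξ : Fin k → ℝ} (hξ : ξ ∈ bohrSet A) {a b : Fin k → ℝ} (ha : a ∈ A)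
    (hb : b ∈ A) (hab : 1 / 4 < |ξ ⬝ᵥ (a - b)|) :
    ∃ B ⊆ A, MeasurableSet B ∧
      volume (B + B) + 2 ^ (k + 1) * volume (A \ B) ≤ volume (A + A) ∧
      volume (B + B) + volume B ≤ volume (A + A) := by
  set p : (Fin k → ℝ) → ℤ := fun x => round (ξ ⬝ᵥ (x - b)) with hp
  set q : (Fin k → ℝ) → ℤ := fun x => round (ξ ⬝ᵥ (x - (b + b)))
  have hpm : Measurable p := measurable_round_dotProduct_sub ξ b
  obtain ⟨m, h1, h2⟩ := exists_fibre_volume_add_le hA hfin hpm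
    (measurable_round_dotProduct_sub ξ (b + b) : Measurable q) (by
      intro x hx y hy
      refine round_eq_of_abs_sub_lt ?_
      have e : ξ ⬝ᵥ (x + y - (b + b)) - ((p x + p y : ℤ) : ℝ) =
          (ξ ⬝ᵥ (x - b) - p x) + (ξ ⬝ᵥ (y - b) - p y) := by
        rw [show x + y - (b + b) = (x - b) + (y - b) by abel, dotProduct_add]
        push_cast
        ring
      rw [e]
      have := abs_add_le (ξ ⬝ᵥ (x - b) - p x) (ξ ⬝ᵥ (y - b) - p y)
      have hx' := hξ x hx b hb
      have hy' := hξ y hy b hb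
      linarith)
  refine ⟨A ∩ p ⁻¹' {m}, inter_subset_left, hA.inter (hpm (measurableSet_singleton m)), ?_, ?_⟩
  · rwa [sdiff_self_inter]
  · have hpb : p b = 0 := by simp [hp]
    have hpa : p a ≠ 0 := by
      intro h0
      have := hξ a ha b hb
      rw [show round (ξ ⬝ᵥ (a - b)) = 0 from h0, Int.cast_zero, sub_zero] at this
      linarith
    by_cases hm : m = 0
    · exact h2 a ha (hm ▸ hpa)
    · exact h2 b hb (by rw [hpb]; exact Ne.symm hm)

theorem stmt_0 (k : ℕ) (hk : 1 ≤ k) (δ : ℝ) (hδ : δ ∈ Set.Ioo (0 : ℝ) 1) :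
    ∃ C : ℝ, 0 < C ∧
      ∀ A : Set (Fin k → ℝ), MeasurableSet A → 0 < volume A → volume A < ⊤ →
        volume (A + A) ≤ ENNReal.ofReal (2 ^ k * (1 + δ)) * volume A →
        ∃ A' : Set (Fin k → ℝ), A' ⊆ A ∧ MeasurableSet A' ∧
          ENNReal.ofReal (1 - δ) * volume A ≤ volume A' ∧
          volume (convexHull ℝ A') ≤ ENNReal.ofReal C * volume A := by
  obtain ⟨hδ0, hδ1⟩ := hδ
  have hδ' : 0 < 1 - δ := by linarith
  obtain ⟨c, hc, hbohr⟩ := exists_le_volume_bohrSet k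
    (κ := 2 ^ k * (1 + δ) / (1 - δ)) (by positivity)
  refine ⟨2 ^ k / c, by positivity, fun A hA hpos hfin hdoub => ?_⟩
  have hAA : volume (A + A) ≠ ⊤ :=
    ne_top_of_le_ne_top (ENNReal.mul_ne_top ENNReal.ofReal_ne_top hfin.ne) hdoub
  set 𝒞 : Set (Set (Fin k → ℝ)) := {B | B ⊆ A ∧ MeasurableSet B ∧
    volume (B + B) + 2 ^ (k + 1) * volume (A \ B) ≤ volume (A + A)}
  have hbig : ∀ B ∈ 𝒞, ENNReal.ofReal (1 - δ) * volume A ≤ volume B := by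
    rintro B ⟨hBA, hB, h⟩
    have hBM : 2 ^ k * volume B ≤ volume (B + B) := two_pow_mul_le_volume_add hB hB le_rfl le_rfl
    have hBfin : volume B ≠ ⊤ := ne_top_of_le_ne_top hfin.ne (measure_mono hBA)
    have hDfin : volume (A \ B) ≠ ⊤ := ne_top_of_le_ne_top hfin.ne (measure_mono sdiff_subset)
    have hsum : volume B + volume (A \ B) = volume A := by
      rw [measure_add_sdiff hB.nullMeasurableSet, union_eq_right.2 hBA]
    have h1 := ((add_le_add_left hBM _).trans h).trans hdoub
    rw [← hsum] at h1 ⊢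
    generalize volume B = x at *
    generalize volume (A \ B) = y at *
    lift x to NNReal using hBfin
    lift y to NNReal using hDfin
    have h2 := ENNReal.toReal_mono (by finiteness) h1
    rw [ENNReal.toReal_add (by finiteness) (by finiteness), ENNReal.toReal_mul,
      ENNReal.toReal_mul, ENNReal.toReal_mul, ENNReal.toReal_ofReal (by positivity),
      ENNReal.toReal_add (by finiteness) (by finiteness)] at h2
    simp only [ENNReal.toReal_pow, ENNReal.toReal_ofNat, ENNReal.coe_toReal] at h2
    have h3 : (2 : ℝ) ^ k * (x + 2 * y) ≤ 2 ^ k * ((1 + δ) * (x + y)) := by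
      rw [pow_succ] at h2
      linarith
    have h4 := le_of_mul_le_mul_left h3 (by positivity)
    rw [← ENNReal.toReal_le_toReal (by finiteness) (by finiteness), ENNReal.toReal_mul,
      ENNReal.toReal_ofReal hδ'.le, ENNReal.toReal_add (by finiteness) (by finiteness),
      ENNReal.coe_toReal, ENNReal.coe_toReal]
    linarith
  have hA𝒞 : A ∈ 𝒞 := ⟨Subset.rfl, hA, by simp⟩
  set I : ENNReal := sInf ((fun B => volume (B + B)) '' 𝒞)
  have hIle : ∀ B ∈ 𝒞, I ≤ volume (B + B) := fun B hB => sInf_le (mem_image_of_mem _ hB)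
  have hε : ENNReal.ofReal (1 - δ) * volume A ≠ 0 :=
    mul_ne_zero (by simpa using hδ') hpos.ne'
  obtain ⟨_, ⟨B, hB, rfl⟩, hBI⟩ := exists_lt_of_csInf_lt ⟨_, mem_image_of_mem _ hA𝒞⟩
    (ENNReal.lt_add_right (ne_top_of_le_ne_top hAA (hIle A hA𝒞)) hε)
  refine ⟨B, hB.1, hB.2.1, hbig B hB, ?_⟩
  have hBfin : volume B < ⊤ := (measure_mono hB.1).trans_lt hfin
  have hBpos : 0 < volume B := (pos_iff_ne_zero.2 hε).trans_le (hbig B hB)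
  have hBreal : 0 < volume.real B := ENNReal.toReal_pos hBpos.ne' hBfin.ne
  have hpolar : bohrSet B ⊆ {ξ | ∀ a ∈ B, ∀ b ∈ B, |ξ ⬝ᵥ (a - b)| ≤ 1 / 4} := by
    intro ξ hξ a ha b hb
    by_contra hcon
    obtain ⟨B', hB'B, hB', h1, h2⟩ :=
      exists_subset_volume_add_le hB.2.1 hBfin.ne hξ ha hb (not_le.1 hcon)
    have hB'𝒞 : B' ∈ 𝒞 := by
      refine ⟨hB'B.trans hB.1, hB', le_trans ?_ hB.2.2⟩
      have hsplit : volume (A \ B') ≤ volume (B \ B') + volume (A \ B) := by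
        refine (measure_mono ?_).trans (measure_union_le _ _)
        intro x hx
        by_cases hxB : x ∈ B
        · exact Or.inl ⟨hxB, hx.2⟩
        · exact Or.inr ⟨hx.1, hxB⟩
      calc volume (B' + B') + 2 ^ (k + 1) * volume (A \ B')
          ≤ volume (B' + B') + 2 ^ (k + 1) * (volume (B \ B') + volume (A \ B)) := by gcongr
        _ = volume (B' + B') + 2 ^ (k + 1) * volume (B \ B') + 2 ^ (k + 1) * volume (A \ B) := by
          ring
        _ ≤ _ := by gcongr
    exact absurd (h2.trans_lt hBI)
      (not_lt.2 (add_le_add (hIle B' hB'𝒞) (hbig B' hB'𝒞)))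
  have hBdoub : volume (B + B) ≤ ENNReal.ofReal (2 ^ k * (1 + δ) / (1 - δ)) * volume B := by
    calc volume (B + B) ≤ volume (A + A) := measure_mono (Set.add_subset_add hB.1 hB.1)
      _ ≤ ENNReal.ofReal (2 ^ k * (1 + δ)) * volume A := hdoub
      _ = ENNReal.ofReal (2 ^ k * (1 + δ) / (1 - δ)) *
          (ENNReal.ofReal (1 - δ) * volume A) := by
        rw [← mul_assoc, ← ENNReal.ofReal_mul (by positivity), div_mul_cancel₀ _ hδ'.ne']
      _ ≤ _ := by gcongr; exact hbig B hB
  have hvol := volume_convexHull_le_of_polar hB.2.1 hBpos (v := c / volume.real B)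
    (by positivity) ((hbohr B hB.2.1 hBpos hBfin hBdoub).trans (measure_mono hpolar))
  calc volume (convexHull ℝ B) ≤ ENNReal.ofReal (2 ^ k / (c / volume.real B)) := hvol
    _ = ENNReal.ofReal (2 ^ k / c) * volume B := by
      rw [← div_mul, ENNReal.ofReal_mul (by positivity), ofReal_measureReal hBfin.ne]
    _ ≤ _ := by gcongr; exact hB.1
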